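/- Stam inequality with quantum conditioning: Let X and Y be random variables with values in ℝⁿ correlated with a finite-dimensional quantum system M, with E‖X‖² and E‖Y‖² finite, with the map (x,y) ↦ ρ(x,y) (the state of M conditioned on X = x, Y = y) continuous in trace norm, with all conditional entropies involved finite, with I(X:Y|M) = 0, and with J(X|M) and J(Y|M) finite and strictly positive. Then 1/J(X+Y|M) ≥ 1/J(X|M) + 1/J(Y|M). -/

import Mathlib

open MeasureTheory Real Filter Topology
open scoped ComplexOrder

noncomputable section

/-- `ℝⁿ`. -/
abbrev En (n : ℕ) := EuclideanSpace ℝ (Fin n)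

/-- The density of the standard Gaussian probability measure on `ℝⁿ`. -/
def gaussDensity (n : ℕ) (z : En n) : ℝ :=
  (2 * π) ^ (-(n : ℝ) / 2) * Real.exp (-‖z‖ ^ 2 / 2)

/-- A state of a finite-dimensional quantum system: a positive semidefinite matrix
with unit trace. -/
def IsState {ι : Type*} [Fintype ι] [DecidableEq ι] (ρ : Matrix ι ι ℂ) : Prop :=
  ρ.PosSemidef ∧ ρ.trace = 1

open scoped Classical in
/-- The von Neumann entropy `S(ρ) = -Σᵢ λᵢ ln λᵢ` of a (Hermitian) matrix, the sum running
over its eigenvalues (with the convention `0 ln 0 = 0`; junk value `0` on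
non-Hermitian matrices). -/
def vnEnt {ι : Type*} [Fintype ι] [DecidableEq ι] (ρ : Matrix ι ι ℂ) : ℝ :=
  if h : ρ.IsHermitian then -∑ i, h.eigenvalues i * Real.log (h.eigenvalues i) else 0

/-- The classical (differential or discrete) entropy `S = -∫ p ln p` of a density `p`. -/
def clEnt {α : Type*} [MeasureSpace α] (p : α → ℝ) : ℝ := -∫ a, p a * Real.log (p a)

/-- The average state `∫ p(a) ρ(a) da` of a classical-quantum state. -/
def avgState {α : Type*} [MeasureSpace α] {d : ℕ} (p : α → ℝ)
    (ρ : α → Matrix (Fin d) (Fin d) ℂ) : Matrix (Fin d) (Fin d) ℂ :=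
  Matrix.of fun i j => ∫ a, (p a : ℂ) * ρ a i j

/-- The conditional entropy `S(A|M) = S(M|A) + S(A) - S(M)` of the classical system `A`
of a classical-quantum state `(p, ρ)` given the quantum system `M`. -/
def condEnt {α : Type*} [MeasureSpace α] {d : ℕ} (p : α → ℝ)
    (ρ : α → Matrix (Fin d) (Fin d) ℂ) : ℝ :=
  (∫ a, p a * vnEnt (ρ a)) + clEnt p - vnEnt (avgState p ρ)

/-- The integrability conditions expressing that the conditional entropy `S(A|M)` of the
classical-quantum state `(p, ρ)` is finite. -/
def EntFinite {α : Type*} [MeasureSpace α] {d : ℕ} (p : α → ℝ)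
    (ρ : α → Matrix (Fin d) (Fin d) ℂ) : Prop :=
  Integrable (fun a => p a * Real.log (p a)) ∧ Integrable (fun a => p a * vnEnt (ρ a))

/-- The marginal density of the first variable of a joint density on `ℝⁿ × ℝⁿ`. -/
def margFst {n : ℕ} (p : En n × En n → ℝ) : En n → ℝ := fun x => ∫ y, p (x, y)

/-- The state of `M` conditioned on the first classical variable:
`ρ_X(x) = (∫ p(x,y) ρ(x,y) dy) / p_X(x)`. -/
def margFstState {n d : ℕ} (p : En n × En n → ℝ)
    (ρ : En n × En n → Matrix (Fin d) (Fin d) ℂ) : En n → Matrix (Fin d) (Fin d) ℂ :=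
  fun x => ((margFst p x : ℂ))⁻¹ • Matrix.of fun i j => ∫ y, (p (x, y) : ℂ) * ρ (x, y) i j

/-- The marginal density of the second variable of a joint density on `ℝⁿ × ℝⁿ`. -/
def margSnd {n : ℕ} (p : En n × En n → ℝ) : En n → ℝ := fun y => ∫ x, p (x, y)

/-- The state of `M` conditioned on the second classical variable. -/
def margSndState {n d : ℕ} (p : En n × En n → ℝ)
    (ρ : En n × En n → Matrix (Fin d) (Fin d) ℂ) : En n → Matrix (Fin d) (Fin d) ℂ :=
  fun y => ((margSnd p y : ℂ))⁻¹ • Matrix.of fun i j => ∫ x, (p (x, y) : ℂ) * ρ (x, y) i j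

/-- The density of the sum `X + Y`: `p_S(s) = ∫ p(x, s - x) dx`. -/
def sumDensity {n : ℕ} (p : En n × En n → ℝ) : En n → ℝ := fun s => ∫ x, p (x, s - x)

/-- The state of `M` conditioned on `X + Y = s`. -/
def sumState {n d : ℕ} (p : En n × En n → ℝ)
    (ρ : En n × En n → Matrix (Fin d) (Fin d) ℂ) : En n → Matrix (Fin d) (Fin d) ℂ :=
  fun s => ((sumDensity p s : ℂ))⁻¹ •
    Matrix.of fun i j => ∫ x, (p (x, s - x) : ℂ) * ρ (x, s - x) i j

/-- The conditional mutual information `I(X:Y|M) = S(X|M) + S(Y|M) - S(X,Y|M)` of the two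
classical variables of a joint classical-quantum state on `ℝⁿ × ℝⁿ` given `M`. -/
def condMI {n d : ℕ} (p : En n × En n → ℝ)
    (ρ : En n × En n → Matrix (Fin d) (Fin d) ℂ) : ℝ :=
  condEnt (margFst p) (margFstState p ρ) + condEnt (margSnd p) (margSndState p ρ)
    - condEnt p ρ

/-- The joint density of `(A + c Z, Z)` where `A` has density `q` and `Z` is an independent
standard Gaussian. -/
def noisyDensity {n : ℕ} (c : ℝ) (q : En n → ℝ) : En n × En n → ℝ :=
  fun wz => gaussDensity n wz.2 * q (wz.1 - c • wz.2)

/-- The state of `M` conditioned on `A + c Z = w` and `Z = z`, namely `σ(w - c z)`. -/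
def noisyState {n d : ℕ} (c : ℝ) (σ : En n → Matrix (Fin d) (Fin d) ℂ) :
    En n × En n → Matrix (Fin d) (Fin d) ℂ :=
  fun wz => σ (wz.1 - c • wz.2)

/-- The mutual information `I(A + c Z : Z | M)` for a classical-quantum state `(q, σ)`. -/
def noisyMI {n d : ℕ} (c : ℝ) (q : En n → ℝ) (σ : En n → Matrix (Fin d) (Fin d) ℂ) : ℝ :=
  condMI (noisyDensity c q) (noisyState c σ)

/-- The heat-semigroup-evolved conditional entropy `t ↦ S(A + √t Z | M)`. -/
def heatEnt {n d : ℕ} (q : En n → ℝ) (σ : En n → Matrix (Fin d) (Fin d) ℂ) (t : ℝ) : ℝ :=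
  condEnt (margFst (noisyDensity (Real.sqrt t) q))
    (margFstState (noisyDensity (Real.sqrt t) q) (noisyState (Real.sqrt t) σ))

/-- The difference quotient `I(A + √t Z : Z | M) / t` whose limit as `t → 0⁺` is the
conditional Fisher information `J(A|M)`. -/
def fisherSlope {n d : ℕ} (q : En n → ℝ) (σ : En n → Matrix (Fin d) (Fin d) ℂ) (t : ℝ) : ℝ :=
  noisyMI (Real.sqrt t) q σ / t

/-- The conditional Fisher information `J(A|M) = lim_{t→0⁺} I(A + √t Z : Z | M) / t`, as an
extended real number (the limit always exists, and is computed here as a `limsup`). -/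
def condFisher {n d : ℕ} (q : En n → ℝ) (σ : En n → Matrix (Fin d) (Fin d) ℂ) : EReal :=
  Filter.limsup (fun t : ℝ => ((fisherSlope q σ t : ℝ) : EReal)) (𝓝[>] (0 : ℝ))

/-- The basic regularity hypotheses on a classical-quantum state `(p, ρ)`:
`p` is a probability density and `ρ` is a (trace-norm continuous) family of states. -/
def IsCQState {α : Type*} [MeasureSpace α] [TopologicalSpace α] {d : ℕ} (p : α → ℝ)
    (ρ : α → Matrix (Fin d) (Fin d) ℂ) : Prop :=
  Measurable p ∧ (∀ a, 0 ≤ p a) ∧ (∫ a, p a) = 1 ∧ Continuous ρ ∧ ∀ a, IsState (ρ a)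

/-! ### Linear algebra: a variational formula for the relative entropy -/

/-- Square complex matrices. -/
abbrev Mat (d : ℕ) := Matrix (Fin d) (Fin d) ℂ

/-- An explicit diagonalization. -/
def IsDiag {d : ℕ} (A U : Mat d) (a : Fin d → ℝ) : Prop :=
  U.conjTranspose * U = 1 ∧ U * U.conjTranspose = 1 ∧
    A = U * Matrix.diagonal (fun i => (a i : ℂ)) * U.conjTranspose

lemma isDiag_of_herm {d : ℕ} {A : Mat d} (h : A.IsHermitian) :
    IsDiag A (h.eigenvectorUnitary : Mat d) h.eigenvalues := by
  refine ⟨?_, ?_, ?_⟩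
  · exact Unitary.coe_star_mul_self h.eigenvectorUnitary
  · exact Unitary.coe_mul_star_self h.eigenvectorUnitary
  · conv_lhs => rw [h.spectral_theorem, Unitary.conjStarAlgAut_apply]
    rfl

lemma IsDiag.herm {d : ℕ} {A U : Mat d} {a : Fin d → ℝ} (h : IsDiag A U a) :
    A.IsHermitian := by
  rw [h.2.2]
  apply Matrix.isHermitian_mul_mul_conjTranspose
  rw [Matrix.IsHermitian, Matrix.diagonal_conjTranspose]
  congr 1
  ext i
  simp

lemma vnEnt_of_diag {d : ℕ} {A U : Mat d} {a : Fin d → ℝ} (h : IsDiag A U a) :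
    vnEnt A = -∑ i, a i * Real.log (a i) := by
  have hH := h.herm
  unfold vnEnt
  rw [dif_pos hH]
  have h1 := hH.roots_charpoly_eq_eigenvalues
  have h2 : A.charpoly.roots = Multiset.map (fun i => (a i : ℂ)) Finset.univ.val := by
    rw [h.2.2, Matrix.charpoly_mul_comm, ← mul_assoc, h.1, one_mul, Matrix.charpoly_diagonal,
      Polynomial.roots_prod]
    · simp
    · simp [Finset.prod_ne_zero_iff, Polynomial.X_sub_C_ne_zero]
  rw [h1] at h2
  have h3 := congrArg (fun m => (Multiset.map (fun z : ℂ => z.re * Real.log z.re) m).sum) h2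
  simp only [Multiset.map_map, Function.comp_def] at h3
  have h4 : ∑ i, hH.eigenvalues i * Real.log (hH.eigenvalues i) = ∑ i, a i * Real.log (a i) := by
    simpa [List.sum_ofFn] using h3
  rw [h4]

lemma trace_of_diag {d : ℕ} {A U : Mat d} {a : Fin d → ℝ} (h : IsDiag A U a) :
    A.trace.re = ∑ i, a i := by
  rw [h.2.2, Matrix.trace_mul_comm, ← mul_assoc, h.1, one_mul, Matrix.trace_diagonal]
  simp

lemma IsDiag.smul {d : ℕ} {A U : Mat d} {a : Fin d → ℝ} (h : IsDiag A U a) (c : ℝ) :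
    IsDiag ((c : ℂ) • A) U (fun i => c * a i) := by
  refine ⟨h.1, h.2.1, ?_⟩
  rw [h.2.2]
  have : Matrix.diagonal (fun i => ((c * a i : ℝ) : ℂ)) =
      (c : ℂ) • Matrix.diagonal (fun i => (a i : ℂ)) := by
    ext i j
    by_cases hij : i = j
    · subst hij; simp
    · simp [hij]
  rw [this]
  simp

lemma vnEnt_smul {d : ℕ} {A : Mat d} (hA : A.IsHermitian) (c : ℝ) :
    vnEnt ((c : ℂ) • A) = c * vnEnt A - c * Real.log c * A.trace.re := by
  have h := isDiag_of_herm hA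
  rw [vnEnt_of_diag (h.smul c), vnEnt_of_diag h, trace_of_diag h]
  rw [mul_neg, Finset.mul_sum, Finset.mul_sum, ← Finset.sum_neg_distrib, ← Finset.sum_neg_distrib,
    ← Finset.sum_sub_distrib]
  refine Finset.sum_congr rfl fun i _ => ?_
  by_cases hc : c = 0
  · simp [hc]
  by_cases ha : hA.eigenvalues i = 0
  · simp [ha]
  rw [Real.log_mul hc ha]
  ring

lemma vnEnt_zero {d : ℕ} : vnEnt (0 : Mat d) = 0 := by
  have := vnEnt_smul (A := (0 : Mat d)) (by simp) 0
  simpa using this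

/-- The linear functional whose supremum over `V` is the integrand of the relative entropy. -/
def linF {d : ℕ} (s : ℝ) (V A B : Mat d) : ℝ :=
  2 * (V.conjTranspose * A).trace.re - (V.conjTranspose * B * V).trace.re
    - s * (V.conjTranspose * V * A).trace.re - A.trace.re / (1 + s)
    + (B.trace.re - A.trace.re) / (1 + s) ^ 2

/-- The scalar version of the integrand. -/
def qf (s a b : ℝ) : ℝ := a ^ 2 / (b + s * a) - a / (1 + s) + (b - a) / (1 + s) ^ 2

lemma trace_conj_mul_re {d : ℕ} (X Y : Mat d) :
    (X.conjTranspose * Y).trace.re = ∑ j, ∑ i, ((starRingEnd ℂ) (X j i) * Y j i).re := by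
  simp only [Matrix.trace, Matrix.diag, Matrix.mul_apply, Matrix.conjTranspose_apply,
    Complex.re_sum]
  rw [Finset.sum_comm]
  rfl

lemma overlap_row {d : ℕ} {C : Mat d} (h : C.conjTranspose * C = 1) (i : Fin d) :
    ∑ j, Complex.normSq (C j i) = 1 := by
  have := congrFun (congrFun h i) i
  rw [Matrix.mul_apply] at this
  simp only [Matrix.conjTranspose_apply, Matrix.one_apply_eq] at this
  have h2 := congrArg Complex.re this
  rw [Complex.re_sum] at h2
  simp only [Complex.one_re] at h2
  rw [← h2]
  refine Finset.sum_congr rfl fun j _ => ?_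
  simp [Complex.normSq_apply]

lemma overlap_col {d : ℕ} {C : Mat d} (h : C * C.conjTranspose = 1) (j : Fin d) :
    ∑ i, Complex.normSq (C j i) = 1 := by
  have := overlap_row (C := C.conjTranspose) (by simpa using h) j
  simpa [Complex.normSq_conj] using this

lemma linF_diag {d : ℕ} {A B U W : Mat d} {a b : Fin d → ℝ} (hA : IsDiag A U a)
    (hB : IsDiag B W b) (s : ℝ) (X : Mat d) :
    linF s (W * X * U.conjTranspose) A B =
      ∑ j, ∑ i, (2 * a i * ((starRingEnd ℂ) (X j i) * (W.conjTranspose * U) j i).re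
        - (b j + s * a i) * Complex.normSq (X j i))
      - (∑ i, a i) / (1 + s) + (∑ j, b j - ∑ i, a i) / (1 + s) ^ 2 := by
  unfold linF
  rw [trace_of_diag hA, trace_of_diag hB]
  have e1 : ((W * X * U.conjTranspose).conjTranspose * A).trace =
      (X.conjTranspose * (W.conjTranspose * U * Matrix.diagonal (fun i => (a i : ℂ)))).trace := by
    conv_lhs => rw [hA.2.2]
    simp only [Matrix.conjTranspose_mul, Matrix.conjTranspose_conjTranspose]
    rw [← mul_assoc, Matrix.trace_mul_comm]
    simp only [← mul_assoc]
    rw [hA.1, one_mul]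
  have e2 : ((W * X * U.conjTranspose).conjTranspose * B * (W * X * U.conjTranspose)).trace =
      (X.conjTranspose * (Matrix.diagonal (fun i => (b i : ℂ)) * X)).trace := by
    conv_lhs => rw [hB.2.2]
    simp only [Matrix.conjTranspose_mul, Matrix.conjTranspose_conjTranspose]
    simp only [← mul_assoc]
    rw [Matrix.trace_mul_comm]
    simp only [← mul_assoc]
    rw [hA.1, one_mul]
    have : X.conjTranspose * W.conjTranspose * W * Matrix.diagonal (fun i => (b i : ℂ))
        * W.conjTranspose * W * X = X.conjTranspose * (W.conjTranspose * W) *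
          Matrix.diagonal (fun i => (b i : ℂ)) * (W.conjTranspose * W) * X := by
      simp only [mul_assoc]
    rw [this, hB.1, mul_one, mul_one]
  have e3 : ((W * X * U.conjTranspose).conjTranspose * (W * X * U.conjTranspose) * A).trace =
      (X.conjTranspose * (X * Matrix.diagonal (fun i => (a i : ℂ)))).trace := by
    conv_lhs => rw [hA.2.2]
    simp only [Matrix.conjTranspose_mul, Matrix.conjTranspose_conjTranspose]
    simp only [← mul_assoc]
    rw [Matrix.trace_mul_comm]
    simp only [← mul_assoc]
    rw [hA.1, one_mul]
    have : X.conjTranspose * W.conjTranspose * W * X * U.conjTranspose * U *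
        Matrix.diagonal (fun i => (a i : ℂ)) = X.conjTranspose * (W.conjTranspose * W) * X *
          (U.conjTranspose * U) * Matrix.diagonal (fun i => (a i : ℂ)) := by
      simp only [mul_assoc]
    rw [this, hB.1, hA.1, mul_one, mul_one]
  rw [e1, e2, e3, trace_conj_mul_re, trace_conj_mul_re, trace_conj_mul_re]
  congr 2
  rw [Finset.mul_sum, Finset.mul_sum, ← Finset.sum_sub_distrib, ← Finset.sum_sub_distrib]
  refine Finset.sum_congr rfl fun j _ => ?_
  rw [Finset.mul_sum, Finset.mul_sum, ← Finset.sum_sub_distrib, ← Finset.sum_sub_distrib]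
  refine Finset.sum_congr rfl fun i _ => ?_
  rw [Matrix.mul_diagonal, Matrix.diagonal_mul, Matrix.mul_diagonal]
  simp [Complex.normSq_apply]
  ring

lemma overlap_unitary {d : ℕ} {U W : Mat d} (hU : U.conjTranspose * U = 1)
    (hW : W * W.conjTranspose = 1) :
    (W.conjTranspose * U).conjTranspose * (W.conjTranspose * U) = 1 := by
  simp only [Matrix.conjTranspose_mul, Matrix.conjTranspose_conjTranspose]
  have : U.conjTranspose * W * (W.conjTranspose * U) =
    U.conjTranspose * (W * W.conjTranspose) * U := by simp only [mul_assoc]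
  rw [this, hW, mul_one, hU]

lemma sum_overlap_left {d : ℕ} {A B U W : Mat d} {a b : Fin d → ℝ} (hA : IsDiag A U a)
    (hB : IsDiag B W b) (f : Fin d → ℝ) :
    ∑ j, ∑ i, Complex.normSq ((W.conjTranspose * U) j i) * f i = ∑ i, f i := by
  rw [Finset.sum_comm]
  refine Finset.sum_congr rfl fun i _ => ?_
  rw [← Finset.sum_mul, overlap_row (overlap_unitary hA.1 hB.2.1), one_mul]

lemma sum_overlap_right {d : ℕ} {A B U W : Mat d} {a b : Fin d → ℝ} (hA : IsDiag A U a)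
    (hB : IsDiag B W b) (f : Fin d → ℝ) :
    ∑ j, ∑ i, Complex.normSq ((W.conjTranspose * U) j i) * f j = ∑ j, f j := by
  refine Finset.sum_congr rfl fun j _ => ?_
  rw [← Finset.sum_mul, overlap_col _ j, one_mul]
  have := overlap_unitary (U := W) (W := U) hB.1 hA.2.1
  simpa [Matrix.conjTranspose_mul] using this

/-- The spectral value of the integrand. -/
def qval {d : ℕ} (s : ℝ) (U W : Mat d) (a b : Fin d → ℝ) : ℝ :=
  ∑ j, ∑ i, Complex.normSq ((W.conjTranspose * U) j i) * qf s (a i) (b j)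

lemma qval_eq {d : ℕ} {A B U W : Mat d} {a b : Fin d → ℝ} (hA : IsDiag A U a)
    (hB : IsDiag B W b) (s : ℝ) :
    qval s U W a b = ∑ j, ∑ i, Complex.normSq ((W.conjTranspose * U) j i) *
      (a i ^ 2 / (b j + s * a i)) - (∑ i, a i) / (1 + s) + (∑ j, b j - ∑ i, a i) / (1 + s) ^ 2 := by
  have h1 := sum_overlap_left hA hB (fun i => a i / (1 + s) + a i / (1 + s) ^ 2)
  have h2 := sum_overlap_right hA hB (fun j => b j / (1 + s) ^ 2)
  rw [Finset.sum_add_distrib, ← Finset.sum_div, ← Finset.sum_div] at h1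
  rw [← Finset.sum_div] at h2
  rw [sub_div, ← h2]
  have : ∀ x y z w v : ℝ, x = y + w - (z + v) → x = y - z + (w - v) := by intros; linarith
  apply this
  rw [← h1]
  simp only [← Finset.sum_add_distrib, ← Finset.sum_sub_distrib]
  refine Finset.sum_congr rfl fun j _ => Finset.sum_congr rfl fun i _ => ?_
  unfold qf
  ring

lemma linF_le {d : ℕ} {A B U W : Mat d} {a b : Fin d → ℝ} (hA : IsDiag A U a)
    (hB : IsDiag B W b) (ha : ∀ i, 0 ≤ a i) (hb : ∀ i, 0 ≤ b i) {s : ℝ} (hs : 0 < s) (V : Mat d) :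
    linF s V A B ≤ qval s U W a b := by
  have hV : V = W * (W.conjTranspose * V * U) * U.conjTranspose := by
    have : W * (W.conjTranspose * V * U) * U.conjTranspose =
      (W * W.conjTranspose) * V * (U * U.conjTranspose) := by simp only [mul_assoc]
    rw [this, hA.2.1, hB.2.1, one_mul, mul_one]
  rw [hV, linF_diag hA hB, qval_eq hA hB]
  gcongr with j _ i _
  set X := W.conjTranspose * V * U
  set c := (W.conjTranspose * U) j i
  set x := X j i
  have hk : 0 ≤ b j + s * a i := add_nonneg (hb j) (mul_nonneg hs.le (ha i))
  rcases hk.eq_or_lt with h0 | hk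
  · have : a i = 0 := by
      have h1 := hb j
      have h2 := mul_nonneg hs.le (ha i)
      have : s * a i = 0 := by linarith
      rcases mul_eq_zero.1 this with h | h
      · exact absurd h hs.ne'
      · exact h
    rw [← h0, this]
    simp
  · rw [mul_div_assoc', le_div_iff₀ hk]
    have h := Complex.normSq_nonneg ((a i : ℂ) * c - ((b j + s * a i : ℝ) : ℂ) * x)
    rw [Complex.normSq_apply] at h
    simp only [Complex.normSq_apply, Complex.mul_re, Complex.conj_re, Complex.conj_im,
      Complex.sub_re, Complex.sub_im, Complex.mul_im, Complex.ofReal_re, Complex.ofReal_im] at h ⊢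
    nlinarith [h]

lemma linF_attain {d : ℕ} {A B U W : Mat d} {a b : Fin d → ℝ} (hA : IsDiag A U a)
    (hB : IsDiag B W b) (ha : ∀ i, 0 ≤ a i) (hb : ∀ i, 0 ≤ b i) {s : ℝ} (hs : 0 < s) :
    ∃ V, linF s V A B = qval s U W a b := by
  refine ⟨W * Matrix.of (fun j i => ((a i / (b j + s * a i) : ℝ) : ℂ) *
    (W.conjTranspose * U) j i) * U.conjTranspose, ?_⟩
  rw [linF_diag hA hB, qval_eq hA hB]
  congr 2
  refine Finset.sum_congr rfl fun j _ => Finset.sum_congr rfl fun i _ => ?_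
  have hk : 0 ≤ b j + s * a i := add_nonneg (hb j) (mul_nonneg hs.le (ha i))
  simp only [Matrix.of_apply]
  set c := (W.conjTranspose * U) j i
  rcases hk.eq_or_lt with h0 | hk
  · rw [← h0]; simp
  · simp only [Complex.normSq_apply, Complex.mul_re, Complex.conj_re, Complex.conj_im,
      Complex.mul_im, Complex.ofReal_re, Complex.ofReal_im]
    have hne := hk.ne'
    clear hk
    generalize b j + s * a i = k at *
    field_simp
    ring

/-! ### The relative entropy as an integral of suprema of linear functionals -/

instance matMeasurableSpace (d : ℕ) : MeasurableSpace (Mat d) :=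
  inferInstanceAs (MeasurableSpace (Fin d → Fin d → ℂ))
instance matSecondCountable (d : ℕ) : SecondCountableTopology (Mat d) :=
  inferInstanceAs (SecondCountableTopology (Fin d → Fin d → ℂ))
instance matBorel (d : ℕ) : BorelSpace (Mat d) :=
  inferInstanceAs (BorelSpace (Fin d → Fin d → ℂ))

lemma measurable_entry {d : ℕ} (i j : Fin d) : Measurable (fun A : Mat d => A i j) := by
  have : Measurable (fun A : Fin d → Fin d → ℂ => A i j) := by fun_prop
  exact this

lemma measurable_mat {α : Type*} [MeasurableSpace α] {d : ℕ} {f : α → Mat d}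
    (h : ∀ i j, Measurable (fun a => f a i j)) : Measurable f := by
  have : Measurable (fun a => (f a : Fin d → Fin d → ℂ)) :=
    measurable_pi_lambda _ fun i => measurable_pi_lambda _ fun j => h i j
  exact this

/-- A dense sequence of matrices. -/
@[irreducible] def dseq (d : ℕ) : ℕ → Mat d := TopologicalSpace.denseSeq (Mat d)

lemma dseq_dense (d : ℕ) (V : Mat d) : V ∈ closure (Set.range (dseq d)) := by
  unfold dseq
  exact (TopologicalSpace.denseRange_denseSeq (Mat d)) V

/-- The (normalized) relative entropy `Tr A (ln A - ln B) - Tr A + Tr B`. -/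
def Dt {d : ℕ} (A B : Mat d) : ENNReal :=
  ∫⁻ s in Set.Ioi (0 : ℝ), ⨆ k : ℕ,
    ENNReal.ofReal (linF s (dseq d k) A B)

lemma measurable_linF {d : ℕ} (V : Mat d) :
    Measurable (fun p : ℝ × (Mat d × Mat d) => linF p.1 V p.2.1 p.2.2) := by
  have h1 : Measurable (fun A : Mat d => (V.conjTranspose * A).trace.re) :=
    (by fun_prop : Continuous _).measurable
  have h2 : Measurable (fun B : Mat d => (V.conjTranspose * B * V).trace.re) :=
    (by fun_prop : Continuous _).measurable
  have h3 : Measurable (fun A : Mat d => (V.conjTranspose * V * A).trace.re) :=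
    (by fun_prop : Continuous _).measurable
  have h4 : Measurable (fun A : Mat d => A.trace.re) :=
    (by fun_prop : Continuous _).measurable
  have k1 : Measurable (fun p : ℝ × (Mat d × Mat d) => p.2.1) := measurable_snd.fst
  have k2 : Measurable (fun p : ℝ × (Mat d × Mat d) => p.2.2) := measurable_snd.snd
  have k0 : Measurable (fun p : ℝ × (Mat d × Mat d) => p.1) := measurable_fst
  unfold linF
  have a1 := h1.comp k1
  have a2 := h2.comp k2
  have a3 := h3.comp k1
  have a4 := h4.comp k1
  have a5 := h4.comp k2
  exact ((((a1.const_mul 2).sub a2).sub (k0.mul a3)).sub (a4.div (k0.const_add 1))).add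
    ((a5.sub a4).div ((k0.const_add 1).pow_const 2))

lemma measurable_supF {d : ℕ} :
    Measurable (fun p : ℝ × (Mat d × Mat d) =>
      ⨆ k : ℕ, ENNReal.ofReal (linF p.1 (dseq d k) p.2.1 p.2.2)) :=
  Measurable.iSup fun _ => (measurable_linF _).ennreal_ofReal

lemma measurable_Dt {d : ℕ} : Measurable (fun p : Mat d × Mat d => Dt p.1 p.2) := by
  unfold Dt
  exact Measurable.lintegral_prod_left' (f := fun p : ℝ × (Mat d × Mat d) =>
      ⨆ k : ℕ, ENNReal.ofReal (linF p.1 (dseq d k) p.2.1 p.2.2))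
    measurable_supF

lemma supF_eq {d : ℕ} {A B U W : Mat d} {a b : Fin d → ℝ} (hA : IsDiag A U a)
    (hB : IsDiag B W b) (ha : ∀ i, 0 ≤ a i) (hb : ∀ i, 0 ≤ b i) {s : ℝ} (hs : 0 < s) :
    ⨆ k : ℕ, ENNReal.ofReal (linF s (dseq d k) A B) =
      ENNReal.ofReal (qval s U W a b) := by
  apply le_antisymm
  · exact iSup_le fun k => ENNReal.ofReal_le_ofReal (linF_le hA hB ha hb hs _)
  · obtain ⟨V, hV⟩ := linF_attain hA hB ha hb hs
    rw [← hV]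
    have hc : Continuous (fun V : Mat d => ENNReal.ofReal (linF s V A B)) := by
      have h1 : Continuous (fun V : Mat d => (V.conjTranspose * A).trace.re) :=
        Complex.continuous_re.comp (continuous_id.matrix_conjTranspose.matrix_mul
          continuous_const).matrix_trace
      have h2 : Continuous (fun V : Mat d => (V.conjTranspose * B * V).trace.re) :=
        Complex.continuous_re.comp ((continuous_id.matrix_conjTranspose.matrix_mul
          continuous_const).matrix_mul continuous_id).matrix_trace
      have h3 : Continuous (fun V : Mat d => (V.conjTranspose * V * A).trace.re) :=
        Complex.continuous_re.comp ((continuous_id.matrix_conjTranspose.matrix_mul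
          continuous_id).matrix_mul continuous_const).matrix_trace
      exact ENNReal.continuous_ofReal.comp
        ((((h1.const_mul 2).sub h2).sub (h3.const_mul s)).sub continuous_const |>.add
          continuous_const)
    have hcl : IsClosed {V' : Mat d | ENNReal.ofReal (linF s V' A B) ≤
        ⨆ k : ℕ, ENNReal.ofReal (linF s (dseq d k) A B)} :=
      isClosed_le hc continuous_const
    refine closure_minimal ?_ hcl (dseq_dense d V)
    rintro _ ⟨k, rfl⟩
    exact le_iSup (fun k => ENNReal.ofReal
      (linF s (dseq d k) A B)) k

lemma qf_eq {s a b : ℝ} (hs : 0 < s) (ha : 0 ≤ a) (hb : 0 < b) :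
    qf s a b = (b - a) ^ 2 / ((b + s * a) * (1 + s) ^ 2) := by
  unfold qf
  have h1 : (b + s * a) ≠ 0 := by positivity
  have h2 : 1 + s ≠ 0 := by positivity
  field_simp
  ring

lemma qf_nonneg {s a b : ℝ} (hs : 0 < s) (ha : 0 ≤ a) (hb : 0 < b) : 0 ≤ qf s a b := by
  rw [qf_eq hs ha hb]; positivity

/-- Scalar value of the integral. -/
def rel (a b : ℝ) : ℝ := a * Real.log a - a * Real.log b - a + b

lemma rel_nonneg {a b : ℝ} (ha : 0 ≤ a) (hb : 0 < b) : 0 ≤ rel a b := by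
  unfold rel
  rcases ha.eq_or_lt with h | h
  · rw [← h]; simp [hb.le]
  · have := Real.log_le_sub_one_of_pos (div_pos hb h)
    rw [Real.log_div hb.ne' h.ne'] at this
    have h2 := mul_le_mul_of_nonneg_left this h.le
    have h3 : a * (b / a - 1) = b - a := by field_simp
    rw [h3] at h2
    nlinarith

lemma lintegral_qf {a b : ℝ} (ha : 0 ≤ a) (hb : 0 < b) :
    ∫⁻ s in Set.Ioi (0 : ℝ), ENNReal.ofReal (qf s a b) = ENNReal.ofReal (rel a b) := by
  set G : ℝ → ℝ := fun s => a * Real.log (b + s * a) - a * Real.log (1 + s) - (b - a) / (1 + s)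
    with hG
  have hder : ∀ s ∈ Set.Ici (0 : ℝ), HasDerivAt G (qf s a b) s := by
    intro s hs
    have hs : 0 ≤ s := hs
    have h1 : (b + s * a) ≠ 0 := by positivity
    have h2 : 1 + s ≠ 0 := by positivity
    have d1 : HasDerivAt (fun s : ℝ => b + s * a) a s := by
      simpa using ((hasDerivAt_id s).mul_const a).const_add b
    have d2 : HasDerivAt (fun s : ℝ => 1 + s) 1 s := (hasDerivAt_id s).const_add 1
    refine ((((d1.log h1).const_mul a).sub ((d2.log h2).const_mul a)).sub
      ((hasDerivAt_const s (b - a)).div d2 h2)).congr_deriv ?_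
    unfold qf
    field_simp
    ring
  have hpos : ∀ s ∈ Set.Ioi (0 : ℝ), 0 ≤ qf s a b := fun s hs => qf_nonneg hs ha hb
  have hlim : Tendsto G atTop (𝓝 (a * Real.log a)) := by
    have t0 : Tendsto (fun s : ℝ => 1 + s) atTop atTop := tendsto_atTop_add_const_left _ _ tendsto_id
    have t1 : Tendsto (fun s : ℝ => (b - a) / (1 + s)) atTop (𝓝 0) := t0.const_div_atTop _
    rcases ha.eq_or_lt with h | h
    · rw [hG, ← h]
      simp only [zero_mul, sub_zero, zero_sub]
      have := t1.neg
      rw [← h] at this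
      simpa using this
    · have t2 : Tendsto (fun s : ℝ => (b + s * a) / (1 + s)) atTop (𝓝 a) := by
        have e : (fun s : ℝ => a + (b - a) / (1 + s)) =ᶠ[atTop] fun s => (b + s * a) / (1 + s) := by
          filter_upwards [eventually_gt_atTop 0] with s hs
          have h2 : 1 + s ≠ 0 := by positivity
          field_simp
          ring
        have := (tendsto_const_nhds (x := a)).add t1
        rw [add_zero] at this
        exact this.congr' e
      have t3 := (((Real.continuousAt_log h.ne').tendsto.comp t2).const_mul a).sub t1
      rw [sub_zero] at t3
      refine t3.congr' ?_
      filter_upwards [eventually_gt_atTop 0] with s hs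
      have h1 : (b + s * a) ≠ 0 := by positivity
      have h2 : 1 + s ≠ 0 := by positivity
      simp only [Function.comp, hG]
      rw [Real.log_div h1 h2]
      ring
  have hintg := integrableOn_Ioi_deriv_of_nonneg' hder hpos hlim
  have hval := integral_Ioi_of_hasDerivAt_of_nonneg' hder hpos hlim
  rw [← ofReal_integral_eq_lintegral_ofReal hintg, hval]
  · congr 1
    simp only [hG]
    unfold rel
    simp
    ring
  · rw [EventuallyLE, ae_restrict_iff' measurableSet_Ioi]
    exact ae_of_all _ hpos

/-- Diagonal entry of `A` in the basis given by `W`. -/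
def dg {d : ℕ} (W A : Mat d) (j : Fin d) : ℝ := ((W.conjTranspose * A * W) j j).re

lemma dg_eq {d : ℕ} {A U : Mat d} {a : Fin d → ℝ} (hA : IsDiag A U a) (W : Mat d) (j : Fin d) :
    dg W A j = ∑ i, Complex.normSq ((W.conjTranspose * U) j i) * a i := by
  unfold dg
  have : W.conjTranspose * A * W = (W.conjTranspose * U) * Matrix.diagonal (fun i => (a i : ℂ)) *
      (W.conjTranspose * U).conjTranspose := by
    rw [hA.2.2]
    simp only [Matrix.conjTranspose_mul, Matrix.conjTranspose_conjTranspose, mul_assoc]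
  rw [this, Matrix.mul_apply, Complex.re_sum]
  refine Finset.sum_congr rfl fun i _ => ?_
  rw [Matrix.mul_diagonal]
  simp [Complex.normSq_apply]
  ring

lemma dg_self {d : ℕ} {B W : Mat d} {b : Fin d → ℝ} (hB : IsDiag B W b) (j : Fin d) :
    dg W B j = b j := by
  rw [dg_eq hB, hB.1]
  rw [Finset.sum_eq_single j]
  · simp
  · intro i _ hij
    simp [Matrix.one_apply, hij.symm]
  · simp

lemma dg_nonneg {d : ℕ} {A : Mat d} (hA : A.PosSemidef) (W : Mat d) (j : Fin d) :
    0 ≤ dg W A j := by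
  rw [dg_eq (isDiag_of_herm hA.1)]
  exact Finset.sum_nonneg fun i _ => mul_nonneg (Complex.normSq_nonneg _) (hA.eigenvalues_nonneg i)

lemma Dt_diag {d : ℕ} {A B U W : Mat d} {a b : Fin d → ℝ} (hA : IsDiag A U a)
    (hB : IsDiag B W b) (ha : ∀ i, 0 ≤ a i) (hb : ∀ i, 0 ≤ b i)
    (hsupp : ∀ j i, Complex.normSq ((W.conjTranspose * U) j i) ≠ 0 → a i ≠ 0 → b j ≠ 0) :
    0 ≤ ∑ j, ∑ i, Complex.normSq ((W.conjTranspose * U) j i) * rel (a i) (b j) ∧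
    Dt A B = ENNReal.ofReal
      (∑ j, ∑ i, Complex.normSq ((W.conjTranspose * U) j i) * rel (a i) (b j)) := by
  have key : ∀ j i, (0 ≤ Complex.normSq ((W.conjTranspose * U) j i) * rel (a i) (b j)) ∧
      (∀ s, 0 < s → 0 ≤ Complex.normSq ((W.conjTranspose * U) j i) * qf s (a i) (b j)) ∧
      ∫⁻ s in Set.Ioi (0 : ℝ), ENNReal.ofReal
        (Complex.normSq ((W.conjTranspose * U) j i) * qf s (a i) (b j)) =
      ENNReal.ofReal (Complex.normSq ((W.conjTranspose * U) j i) * rel (a i) (b j)) := by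
    intro j i
    by_cases hw : Complex.normSq ((W.conjTranspose * U) j i) = 0
    · simp [hw]
    by_cases hb0 : b j = 0
    · have ha0 : a i = 0 := by
        by_contra h
        exact hsupp j i hw h hb0
      simp [hb0, ha0, qf, rel]
    · have hbp : 0 < b j := lt_of_le_of_ne (hb j) (Ne.symm hb0)
      have hw' := Complex.normSq_nonneg ((W.conjTranspose * U) j i)
      refine ⟨mul_nonneg hw' (rel_nonneg (ha i) hbp),
        fun s hs => mul_nonneg hw' (qf_nonneg hs (ha i) hbp), ?_⟩
      simp only [ENNReal.ofReal_mul hw']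
      rw [lintegral_const_mul' _ _ ENNReal.ofReal_ne_top, lintegral_qf (ha i) hbp]
  refine ⟨Finset.sum_nonneg fun j _ => Finset.sum_nonneg fun i _ => (key j i).1, ?_⟩
  unfold Dt
  rw [setLIntegral_congr_fun measurableSet_Ioi
    (fun s hs => supF_eq hA hB ha hb (s := s) hs)]
  have hm : ∀ j i, Measurable (fun s : ℝ => ENNReal.ofReal
      (Complex.normSq ((W.conjTranspose * U) j i) * qf s (a i) (b j))) := by
    intro j i
    unfold qf
    fun_prop
  have e1 : ∫⁻ s in Set.Ioi (0 : ℝ), ENNReal.ofReal (qval s U W a b) =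
      ∫⁻ s in Set.Ioi (0 : ℝ), ∑ j, ∑ i, ENNReal.ofReal
        (Complex.normSq ((W.conjTranspose * U) j i) * qf s (a i) (b j)) := by
    refine setLIntegral_congr_fun measurableSet_Ioi fun s hs => ?_
    simp only [qval]
    rw [ENNReal.ofReal_sum_of_nonneg
      fun j _ => Finset.sum_nonneg fun i _ => (key j i).2.1 s hs]
    refine Finset.sum_congr rfl fun j _ => ?_
    rw [ENNReal.ofReal_sum_of_nonneg fun i _ => (key j i).2.1 s hs]
  rw [e1, lintegral_finsetSum _ fun j _ => Finset.measurable_sum _ fun i _ => hm j i,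
    ENNReal.ofReal_sum_of_nonneg fun j _ => Finset.sum_nonneg fun i _ => (key j i).1]
  refine Finset.sum_congr rfl fun j _ => ?_
  rw [lintegral_finsetSum _ fun i _ => hm j i,
    ENNReal.ofReal_sum_of_nonneg fun i _ => (key j i).1]
  exact Finset.sum_congr rfl fun i _ => (key j i).2.2

lemma Dt_eq {d : ℕ} {A B W : Mat d} {b : Fin d → ℝ} (hA : A.PosSemidef)
    (hB : IsDiag B W b) (hb : ∀ i, 0 ≤ b i) (hs : ∀ j, b j = 0 → dg W A j = 0) :
    0 ≤ -vnEnt A - ∑ j, dg W A j * Real.log (b j) - A.trace.re + B.trace.re ∧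
    Dt A B = ENNReal.ofReal
      (-vnEnt A - ∑ j, dg W A j * Real.log (b j) - A.trace.re + B.trace.re) := by
  have hD := isDiag_of_herm hA.1
  have ha := hA.eigenvalues_nonneg
  have hsupp : ∀ j i, Complex.normSq ((W.conjTranspose * (hA.1.eigenvectorUnitary : Mat d)) j i) ≠ 0
      → hA.1.eigenvalues i ≠ 0 → b j ≠ 0 := by
    intro j i hw hai hbj
    have := hs j hbj
    rw [dg_eq hD] at this
    rw [Finset.sum_eq_zero_iff_of_nonneg
      fun i _ => mul_nonneg (Complex.normSq_nonneg _) (ha i)] at this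
    rcases mul_eq_zero.1 (this i (Finset.mem_univ _)) with h | h
    · exact hw h
    · exact hai h
  have h := Dt_diag hD hB ha hb hsupp
  have e : ∑ j, ∑ i, Complex.normSq ((W.conjTranspose * (hA.1.eigenvectorUnitary : Mat d)) j i) *
      rel (hA.1.eigenvalues i) (b j) =
      -vnEnt A - ∑ j, dg W A j * Real.log (b j) - A.trace.re + B.trace.re := by
    rw [vnEnt_of_diag hD, trace_of_diag hD, trace_of_diag hB,
      ← sum_overlap_left hD hB (fun i => hA.1.eigenvalues i),
      ← sum_overlap_left hD hB (fun i => hA.1.eigenvalues i * Real.log (hA.1.eigenvalues i)),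
      ← sum_overlap_right hD hB b, neg_neg]
    simp only [← Finset.sum_add_distrib, ← Finset.sum_sub_distrib, dg_eq hD, Finset.sum_mul]
    refine Finset.sum_congr rfl fun j _ => Finset.sum_congr rfl fun i _ => ?_
    unfold rel
    ring
  rw [e] at h
  exact h

/-- Entrywise integral of a matrix-valued function. -/
def mint {α : Type*} [MeasurableSpace α] {d : ℕ} (μ : Measure α) (f : α → Mat d) : Mat d :=
  Matrix.of fun i j => ∫ a, f a i j ∂μ

/-- Entrywise integrability of a matrix-valued function. -/
def MInt {α : Type*} [MeasurableSpace α] {d : ℕ} (f : α → Mat d) (μ : Measure α) : Prop :=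
  ∀ i j, Integrable (fun a => f a i j) μ

lemma MInt.trace {α : Type*} [MeasurableSpace α] {d : ℕ} {μ : Measure α} {f : α → Mat d}
    (h : MInt f μ) : Integrable (fun a => (f a).trace) μ ∧
      ∫ a, (f a).trace ∂μ = (mint μ f).trace := by
  constructor
  · exact integrable_finsetSum _ fun i _ => h i i
  · simp only [Matrix.trace, Matrix.diag]
    rw [integral_finsetSum _ fun i _ => h i i]
    rfl

lemma MInt.mul {α : Type*} [MeasurableSpace α] {d : ℕ} {μ : Measure α} {f : α → Mat d}
    (h : MInt f μ) (K L : Mat d) : MInt (fun a => K * f a * L) μ ∧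
      mint μ (fun a => K * f a * L) = K * mint μ f * L := by
  have h1 : ∀ i j k l, Integrable (fun a => K i k * f a k l * L l j) μ := fun i j k l =>
    ((h k l).const_mul _).mul_const _
  constructor
  · intro i j
    simp only [Matrix.mul_apply, Finset.sum_mul]
    exact integrable_finsetSum _ fun l _ => integrable_finsetSum _ fun k _ => h1 i j k l
  · ext i j
    simp only [mint, Matrix.of_apply, Matrix.mul_apply, Finset.sum_mul]
    rw [integral_finsetSum _ fun l _ => integrable_finsetSum _ fun k _ => h1 i j k l]
    refine Finset.sum_congr rfl fun l _ => ?_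
    rw [integral_finsetSum _ fun k _ => h1 i j k l]
    refine Finset.sum_congr rfl fun k _ => ?_
    rw [integral_mul_const, integral_const_mul]

lemma MInt.trace_re {α : Type*} [MeasurableSpace α] {d : ℕ} {μ : Measure α} {f : α → Mat d}
    (h : MInt f μ) : Integrable (fun a => (f a).trace.re) μ ∧
      ∫ a, (f a).trace.re ∂μ = (mint μ f).trace.re := by
  refine ⟨h.trace.1.re, ?_⟩
  rw [← h.trace.2]
  exact integral_re h.trace.1

lemma MInt.mul_trace_re {α : Type*} [MeasurableSpace α] {d : ℕ} {μ : Measure α} {f : α → Mat d}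
    (h : MInt f μ) (K L : Mat d) : Integrable (fun a => (K * f a * L).trace.re) μ ∧
      ∫ a, (K * f a * L).trace.re ∂μ = (K * mint μ f * L).trace.re := by
  have := (h.mul K L).1.trace_re
  rwa [(h.mul K L).2] at this

lemma MInt.dg {α : Type*} [MeasurableSpace α] {d : ℕ} {μ : Measure α} {f : α → Mat d}
    (h : MInt f μ) (W : Mat d) (j : Fin d) : Integrable (fun a => dg W (f a) j) μ ∧
      ∫ a, dg W (f a) j ∂μ = dg W (mint μ f) j := by
  have h1 := (h.mul W.conjTranspose W).1 j j
  refine ⟨h1.re, ?_⟩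
  have h2 := congrFun (congrFun (h.mul W.conjTranspose W).2 j) j
  unfold _root_.dg
  rw [← h2]
  exact integral_re h1

lemma linF_integral {α : Type*} [MeasurableSpace α] {d : ℕ} {μ : Measure α} {A B : α → Mat d}
    (hA : MInt A μ) (hB : MInt B μ) (s : ℝ) (V : Mat d) :
    Integrable (fun a => linF s V (A a) (B a)) μ ∧
      ∫ a, linF s V (A a) (B a) ∂μ = linF s V (mint μ A) (mint μ B) := by
  have h1 := hA.mul_trace_re V.conjTranspose 1
  have h2 := hB.mul_trace_re V.conjTranspose V
  have h3 := hA.mul_trace_re (V.conjTranspose * V) 1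
  simp only [mul_one] at h1 h3
  have h4 := hA.trace_re
  have h5 := hB.trace_re
  unfold linF
  have e4 : ∫ a, ((B a).trace.re - (A a).trace.re) / (1 + s) ^ 2 ∂μ =
      ((mint μ B).trace.re - (mint μ A).trace.re) / (1 + s) ^ 2 := by
    rw [integral_div, integral_sub h5.1 h4.1, h5.2, h4.2]
  have i1 : Integrable (fun a => 2 * (V.conjTranspose * A a).trace.re -
    (V.conjTranspose * B a * V).trace.re) μ := (h1.1.const_mul 2).sub h2.1
  have i2 : Integrable (fun a => 2 * (V.conjTranspose * A a).trace.re -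
    (V.conjTranspose * B a * V).trace.re - s * (V.conjTranspose * V * A a).trace.re) μ :=
    i1.sub (h3.1.const_mul s)
  have i3 : Integrable (fun a => 2 * (V.conjTranspose * A a).trace.re -
    (V.conjTranspose * B a * V).trace.re - s * (V.conjTranspose * V * A a).trace.re -
    (A a).trace.re / (1 + s)) μ := i2.sub (h4.1.div_const (1 + s))
  have i4 : Integrable (fun a => ((B a).trace.re - (A a).trace.re) / (1 + s) ^ 2) μ :=
    (h5.1.sub h4.1).div_const ((1 + s) ^ 2)
  refine ⟨i3.add i4, ?_⟩
  rw [integral_add i3 i4, e4, integral_sub i2 (h4.1.div_const (1 + s)),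
    integral_sub i1 (h3.1.const_mul s), integral_sub (h1.1.const_mul 2) h2.1, integral_const_mul,
    integral_const_mul, integral_div, h1.2, h2.2, h3.2, h4.2]

lemma ofReal_integral_le' {α : Type*} [MeasurableSpace α] {μ : Measure α} {f : α → ℝ}
    (hf : Integrable f μ) : ENNReal.ofReal (∫ a, f a ∂μ) ≤ ∫⁻ a, ENNReal.ofReal (f a) ∂μ := by
  have h1 : ∫ a, f a ∂μ ≤ ∫ a, max (f a) 0 ∂μ :=
    integral_mono hf hf.pos_part fun a => le_max_left _ _
  refine (ENNReal.ofReal_le_ofReal h1).trans ?_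
  rw [ofReal_integral_eq_lintegral_ofReal hf.pos_part (ae_of_all _ fun a => le_max_right _ _)]
  refine lintegral_mono fun a => ?_
  simp

/-- Joint convexity of the relative entropy. -/
lemma Dt_mint_le {β : Type*} [MeasurableSpace β] {d : ℕ} {μ : Measure β} [SFinite μ]
    {A B : β → Mat d} (hAm : Measurable A) (hBm : Measurable B)
    (hA : MInt A μ) (hB : MInt B μ) :
    Dt (mint μ A) (mint μ B) ≤ ∫⁻ y, Dt (A y) (B y) ∂μ := by
  unfold Dt
  rw [lintegral_lintegral_swap]
  · refine lintegral_mono fun s => ?_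
    refine iSup_le fun k => ?_
    rw [← (linF_integral hA hB s _).2]
    refine (ofReal_integral_le' (linF_integral hA hB s _).1).trans ?_
    refine lintegral_mono fun y => ?_
    exact le_iSup (fun k => ENNReal.ofReal
      (linF s (dseq d k) (A y) (B y))) k
  · refine Measurable.aemeasurable ?_
    have : Measurable (fun q : β × ℝ => (q.2, (A q.1, B q.1))) :=
      measurable_snd.prodMk ((hAm.comp measurable_fst).prodMk (hBm.comp measurable_fst))
    have h2 := (measurable_supF (d := d)).comp this
    exact h2

attribute [irreducible] Dt

lemma isDiag_one (d : ℕ) : IsDiag (1 : Mat d) 1 (fun _ => 1) := by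
  refine ⟨by simp, by simp, ?_⟩
  simp

lemma vnEnt_psd {d : ℕ} {A : Mat d} (hA : A.PosSemidef) :
    vnEnt A = (d : ℝ) - A.trace.re - (Dt A 1).toReal ∧ vnEnt A ≤ (d : ℝ) - A.trace.re := by
  obtain ⟨h0, h1⟩ := Dt_eq hA (isDiag_one d) (fun _ => zero_le_one) (by intro j hj; simp at hj)
  rw [h1, ENNReal.toReal_ofReal h0]
  simp at h0 ⊢
  constructor <;> linarith

lemma measurable_Dt_comp {α : Type*} [MeasurableSpace α] {d : ℕ} {f g : α → Mat d}
    (hf : Measurable f) (hg : Measurable g) : Measurable (fun a => Dt (f a) (g a)) :=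
  Measurable.comp (g := fun p : Mat d × Mat d => Dt p.1 p.2) (f := fun a => (f a, g a))
    measurable_Dt (hf.prodMk hg)

lemma aesm_vnEnt {α : Type*} [MeasurableSpace α] {d : ℕ} {μ : Measure α} {f : α → Mat d}
    (hf : Measurable f) (hp : ∀ᵐ a ∂μ, (f a).PosSemidef) :
    AEStronglyMeasurable (fun a => vnEnt (f a)) μ := by
  have h1 : Measurable (fun a => (d : ℝ) - (f a).trace.re - (Dt (f a) 1).toReal) := by
    have h2 : Measurable (fun A : Mat d => A.trace.re) :=
      (Complex.continuous_re.comp (Continuous.matrix_trace continuous_id)).measurable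
    have h3 : Measurable (fun a => Dt (f a) 1) := measurable_Dt_comp hf measurable_const
    exact (measurable_const.sub (h2.comp hf)).sub h3.ennreal_toReal
  refine h1.aestronglyMeasurable.congr ?_
  filter_upwards [hp] with a ha
  exact (vnEnt_psd ha).1.symm

lemma psd_trace_nonneg {d : ℕ} {A : Mat d} (hA : A.PosSemidef) : 0 ≤ A.trace.re := by
  rw [trace_of_diag (isDiag_of_herm hA.1)]
  exact Finset.sum_nonneg fun i _ => hA.eigenvalues_nonneg i

lemma psd_trace_zero {d : ℕ} {A : Mat d} (hA : A.PosSemidef) (h : A.trace.re = 0) : A = 0 := by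
  have hd := isDiag_of_herm hA.1
  rw [trace_of_diag hd, Finset.sum_eq_zero_iff_of_nonneg
    (fun i _ => hA.eigenvalues_nonneg i)] at h
  rw [hd.2.2]
  have : (fun i => (hA.1.eigenvalues i : ℂ)) = fun _ => 0 := by
    funext i; simp [h i (Finset.mem_univ i)]
  rw [this]; simp

lemma vnEnt_le {d : ℕ} {A : Mat d} (hA : A.PosSemidef) :
    vnEnt A ≤ A.trace.re * Real.log d - A.trace.re * Real.log A.trace.re := by
  have h0 := psd_trace_nonneg hA
  rcases h0.eq_or_lt with h | h
  · rw [psd_trace_zero hA h.symm]; simp [vnEnt_zero]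
  · set t := A.trace.re with ht
    have hd : (0 : ℝ) < d := by
      rcases Nat.eq_zero_or_pos d with h' | h'
      · subst h'; simp [Matrix.trace] at ht; linarith
      · exact_mod_cast h'
    have hc : (0 : ℝ) ≤ d / t := by positivity
    have h1 := (vnEnt_psd (hA.smul (a := ((d / t : ℝ) : ℂ)) (by exact_mod_cast hc))).2
    rw [vnEnt_smul hA.1] at h1
    have h2 : (((d / t : ℝ) : ℂ) • A).trace.re = d := by
      rw [Matrix.trace_smul, smul_eq_mul, Complex.re_ofReal_mul, ← ht]; field_simp
    rw [h2, ← ht, Real.log_div hd.ne' h.ne'] at h1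
    have h3 : (d / t) * (vnEnt A - (t * Real.log d - t * Real.log t)) ≤ 0 := by
      nlinarith
    have h4 : 0 < d / t := by positivity
    nlinarith

lemma vnEnt_ge {d : ℕ} {A : Mat d} (hA : A.PosSemidef) :
    -(A.trace.re * Real.log A.trace.re) ≤ vnEnt A := by
  have hd := isDiag_of_herm hA.1
  rw [vnEnt_of_diag hd, trace_of_diag hd, Finset.sum_mul]
  apply neg_le_neg
  apply Finset.sum_le_sum
  intro i _
  have h0 := hA.eigenvalues_nonneg i
  rcases h0.eq_or_lt with h | h
  · rw [← h]; simp
  · apply mul_le_mul_of_nonneg_left _ h0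
    apply Real.log_le_log h
    exact Finset.single_le_sum (f := hA.1.eigenvalues)
      (fun i _ => hA.eigenvalues_nonneg i) (Finset.mem_univ i)

lemma psd_entry_le {d : ℕ} {A : Mat d} (hA : A.PosSemidef) (i j : Fin d) :
    ‖A i j‖ ≤ A.trace.re := by
  have hd := isDiag_of_herm hA.1
  have hU : ∀ i k, ‖(hA.1.eigenvectorUnitary : Mat d) i k‖ ≤ 1 :=
    fun i k => entry_norm_bound_of_unitary (hA.1.eigenvectorUnitary).2 i k
  rw [trace_of_diag hd]
  conv_lhs => rw [hd.2.2]
  rw [Matrix.mul_apply]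
  refine (norm_sum_le _ _).trans (Finset.sum_le_sum fun k _ => ?_)
  rw [Matrix.mul_diagonal, Matrix.conjTranspose_apply, norm_mul, norm_mul, norm_star,
    Complex.norm_real, Real.norm_of_nonneg (hA.eigenvalues_nonneg k)]
  have h1 := hU i k
  have h2 := hU j k
  have h3 := hA.eigenvalues_nonneg k
  calc _ ≤ 1 * hA.1.eigenvalues k * 1 := by gcongr
    _ = _ := by ring

lemma MInt.of_trace {α : Type*} [MeasurableSpace α] {d : ℕ} {μ : Measure α} {f : α → Mat d}
    (hf : Measurable f) (hp : ∀ᵐ a ∂μ, (f a).PosSemidef)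
    (h : Integrable (fun a => (f a).trace.re) μ) : MInt f μ := fun i j => by
  refine h.mono ((measurable_entry i j).comp hf).aestronglyMeasurable ?_
  filter_upwards [hp] with a ha
  exact (psd_entry_le ha i j).trans (le_abs_self _)

lemma psd_mint {α : Type*} [MeasurableSpace α] {d : ℕ} {μ : Measure α} {f : α → Mat d}
    (hp : ∀ᵐ a ∂μ, (f a).PosSemidef) (h : MInt f μ) : (mint μ f).PosSemidef := by
  refine Matrix.PosSemidef.of_dotProduct_mulVec_nonneg ?_ fun x => ?_
  · ext i j
    rw [Matrix.conjTranspose_apply]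
    simp only [mint, Matrix.of_apply]
    rw [Complex.star_def, ← integral_conj]
    apply integral_congr_ae
    filter_upwards [hp] with a ha
    have := congrFun (congrFun ha.1 i) j
    rw [Matrix.conjTranspose_apply] at this
    exact this
  · have e : star x ⬝ᵥ (mint μ f).mulVec x = ∫ a, star x ⬝ᵥ (f a).mulVec x ∂μ := by
      simp only [dotProduct, Matrix.mulVec, mint, Matrix.of_apply]
      rw [integral_finsetSum]
      · congr 1; ext i
        rw [integral_const_mul, integral_finsetSum]
        · simp only [integral_mul_const]
        · intro j _; exact (h i j).mul_const _
      · intro i _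
        apply Integrable.const_mul
        apply integrable_finsetSum
        intro j _; exact (h i j).mul_const _
    rw [e]
    have e2 : ∫ a, star x ⬝ᵥ (f a).mulVec x ∂μ
        = ∫ a, (((star x ⬝ᵥ (f a).mulVec x).re : ℝ) : ℂ) ∂μ := by
      apply integral_congr_ae
      filter_upwards [hp] with a ha
      have := ha.dotProduct_mulVec_nonneg x
      rw [Complex.nonneg_iff] at this
      apply Complex.ext <;> simp [← this.2]
    rw [e2, integral_complex_ofReal]
    have : 0 ≤ ∫ a, (star x ⬝ᵥ (f a).mulVec x).re ∂μ := by
      apply integral_nonneg_of_ae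
      filter_upwards [hp] with a ha
      have := ha.dotProduct_mulVec_nonneg x
      rw [Complex.nonneg_iff] at this
      exact this.1
    exact_mod_cast this

lemma holevo {α : Type*} [MeasurableSpace α] {d : ℕ} {ν : Measure α} [IsProbabilityMeasure ν]
    {A : α → Mat d} (hp : ∀ᵐ a ∂ν, (A a).PosSemidef)
    (hM : MInt A ν) (hv : Integrable (fun a => vnEnt (A a)) ν) :
    ∫ a, vnEnt (A a) ∂ν ≤ vnEnt (mint ν A) ∧
    ∫⁻ a, Dt (A a) (mint ν A) ∂ν = ENNReal.ofReal (vnEnt (mint ν A) - ∫ a, vnEnt (A a) ∂ν) := by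
  have hB := psd_mint hp hM
  set B := mint ν A with hBdef
  have hD := isDiag_of_herm hB.1
  set W := (hB.1.eigenvectorUnitary : Mat d)
  set b := hB.1.eigenvalues
  have hb : ∀ i, 0 ≤ b i := hB.eigenvalues_nonneg
  have hs : ∀ᵐ a ∂ν, ∀ j, b j = 0 → dg W (A a) j = 0 := by
    rw [ae_all_iff]
    intro j
    by_cases hj : b j = 0
    · have h1 := hM.dg W j
      have h2 : ∫ a, dg W (A a) j ∂ν = 0 := by rw [h1.2, ← hBdef, dg_self hD, hj]
      rw [integral_eq_zero_iff_of_nonneg_ae _ h1.1] at h2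
      · filter_upwards [h2] with a ha _ using ha
      · filter_upwards [hp] with a ha using dg_nonneg ha W j
    · exact ae_of_all _ fun a h => absurd h hj
  set v : α → ℝ := fun a => -vnEnt (A a) - ∑ j, dg W (A a) j * Real.log (b j) - (A a).trace.re
    + B.trace.re with hvdef
  have h1 : ∀ᵐ a ∂ν, 0 ≤ v a ∧ Dt (A a) B = ENNReal.ofReal (v a) := by
    filter_upwards [hp, hs] with a ha hsa
    exact Dt_eq ha hD hb hsa
  have i1 : Integrable (fun a => ∑ j, dg W (A a) j * Real.log (b j)) ν :=
    integrable_finsetSum _ fun j _ => (hM.dg W j).1.mul_const _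
  have i2 : Integrable (fun a => (A a).trace.re) ν := hM.trace_re.1
  have i3 : Integrable (fun a => -vnEnt (A a)) ν := hv.neg
  have i4 : Integrable (fun a => -vnEnt (A a) - ∑ j, dg W (A a) j * Real.log (b j)) ν := i3.sub i1
  have i5 : Integrable (fun a => -vnEnt (A a) - ∑ j, dg W (A a) j * Real.log (b j)
    - (A a).trace.re) ν := i4.sub i2
  have iv : Integrable v ν := i5.add (integrable_const _)
  have e : ∫ a, v a ∂ν = vnEnt B - ∫ a, vnEnt (A a) ∂ν := by
    simp only [hvdef]
    rw [integral_add i5 (integrable_const _), integral_sub i4 i2, integral_sub i3 i1,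
      integral_neg, integral_const, hM.trace_re.2, integral_finsetSum _
      fun j _ => (hM.dg W j).1.mul_const _, vnEnt_of_diag hD]
    simp only [integral_mul_const, (hM.dg W _).2, ← hBdef, dg_self hD]
    simp
    ring
  have hv0 : 0 ≤ᵐ[ν] v := by filter_upwards [h1] with a ha using ha.1
  constructor
  · have := integral_nonneg_of_ae hv0
    rw [e] at this; linarith
  · rw [← e, ofReal_integral_eq_lintegral_ofReal iv hv0]
    apply lintegral_congr_ae
    filter_upwards [h1] with a ha using ha.2

lemma mint_congr {α : Type*} [MeasurableSpace α] {d : ℕ} {μ : Measure α} {f g : α → Mat d}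
    (h : f =ᵐ[μ] g) : mint μ f = mint μ g := by
  ext i j
  simp only [mint, Matrix.of_apply]
  apply integral_congr_ae
  filter_upwards [h] with a ha
  rw [ha]

section slices
variable {α β : Type*} [MeasurableSpace α] [MeasurableSpace β] {d : ℕ} {ν : Measure α}
  {μ : Measure β} [SFinite ν] [SFinite μ] {A : α × β → Mat d}

lemma slice_meas (hm : Measurable A) : Measurable (fun x => mint μ (fun y => A (x, y))) := by
  apply measurable_mat
  intro i j
  have : Measurable (fun p => A p i j) := (measurable_entry i j).comp hm
  exact this.stronglyMeasurable.integral_prod_right.measurable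

lemma slice_meas' (hm : Measurable A) : Measurable (fun y => mint ν (fun x => A (x, y))) :=
  slice_meas (A := fun p => A (p.2, p.1)) (hm.comp measurable_swap)

lemma MInt.slice (hM : MInt A (ν.prod μ)) : ∀ᵐ x ∂ν, MInt (fun y => A (x, y)) μ := by
  have : ∀ i j, ∀ᵐ x ∂ν, Integrable (fun y => A (x, y) i j) μ := fun i j => (hM i j).prod_right_ae
  simp only [← ae_all_iff] at this
  exact this

lemma MInt.swap (hM : MInt A (ν.prod μ)) : MInt (fun p : β × α => A (p.2, p.1)) (μ.prod ν) :=
  fun i j => (hM i j).swap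

lemma MInt.slice' (hM : MInt A (ν.prod μ)) : ∀ᵐ y ∂μ, MInt (fun x => A (x, y)) ν :=
  hM.swap.slice

lemma ae_slice {P : α × β → Prop} (h : ∀ᵐ p ∂(ν.prod μ), P p) : ∀ᵐ x ∂ν, ∀ᵐ y ∂μ, P (x, y) :=
  Measure.ae_ae_of_ae_prod h

lemma ae_swap' {P : α × β → Prop} (h : ∀ᵐ p ∂(ν.prod μ), P p) :
    ∀ᵐ p ∂(μ.prod ν), P (p.2, p.1) :=
  (Measure.measurePreserving_swap (μ := μ) (ν := ν)).quasiMeasurePreserving.ae h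

lemma ae_slice' {P : α × β → Prop} (h : ∀ᵐ p ∂(ν.prod μ), P p) :
    ∀ᵐ y ∂μ, ∀ᵐ x ∂ν, P (x, y) := ae_slice (ae_swap' h)

lemma MInt.marg (hM : MInt A (ν.prod μ)) : MInt (fun x => mint μ (fun y => A (x, y))) ν ∧
    mint ν (fun x => mint μ (fun y => A (x, y))) = mint (ν.prod μ) A := by
  constructor
  · intro i j
    exact (hM i j).integral_prod_left
  · ext i j
    simp only [mint, Matrix.of_apply]
    rw [integral_prod _ (hM i j)]

lemma MInt.marg' (hM : MInt A (ν.prod μ)) : MInt (fun y => mint ν (fun x => A (x, y))) μ ∧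
    mint μ (fun y => mint ν (fun x => A (x, y))) = mint (ν.prod μ) A := by
  refine ⟨hM.swap.marg.1, ?_⟩
  rw [hM.swap.marg.2]
  ext i j
  simp only [mint, Matrix.of_apply]
  exact integral_prod_swap (fun p => A p i j)

lemma psd_marg (hp : ∀ᵐ p ∂(ν.prod μ), (A p).PosSemidef) (hM : MInt A (ν.prod μ)) :
    ∀ᵐ x ∂ν, (mint μ (fun y => A (x, y))).PosSemidef := by
  filter_upwards [ae_slice hp, hM.slice] with x h1 h2 using psd_mint h1 h2

lemma psd_marg' (hp : ∀ᵐ p ∂(ν.prod μ), (A p).PosSemidef) (hM : MInt A (ν.prod μ)) :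
    ∀ᵐ y ∂μ, (mint ν (fun x => A (x, y))).PosSemidef := psd_marg (ae_swap' hp) hM.swap

end slices

/-- Strong subadditivity with one probability reference measure. -/
lemma ssa {α β : Type*} [MeasurableSpace α] [MeasurableSpace β] {d : ℕ} {ν : Measure α}
    {μ : Measure β} [IsProbabilityMeasure ν] [SFinite μ] {A : α × β → Mat d}
    (hm : Measurable A) (hp : ∀ᵐ p ∂(ν.prod μ), (A p).PosSemidef) (hM : MInt A (ν.prod μ))
    (hv : Integrable (fun p => vnEnt (A p)) (ν.prod μ))
    (hv1 : Integrable (fun x => vnEnt (mint μ (fun y => A (x, y)))) ν)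
    (hv2 : Integrable (fun y => vnEnt (mint ν (fun x => A (x, y)))) μ) :
    vnEnt (mint (ν.prod μ) A) - ∫ x, vnEnt (mint μ (fun y => A (x, y))) ∂ν ≤
      ∫ y, vnEnt (mint ν (fun x => A (x, y))) ∂μ - ∫ p, vnEnt (A p) ∂(ν.prod μ) := by
  have H1 := (holevo (psd_marg hp hM) hM.marg.1 hv1).2
  rw [hM.marg.2] at H1
  have hvs : ∀ᵐ y ∂μ, Integrable (fun x => vnEnt (A (x, y))) ν := hv.prod_left_ae
  have H2 : ∀ᵐ y ∂μ, ∫ x, vnEnt (A (x, y)) ∂ν ≤ vnEnt (mint ν (fun x => A (x, y))) ∧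
      ∫⁻ x, Dt (A (x, y)) (mint ν (fun x => A (x, y))) ∂ν = ENNReal.ofReal
        (vnEnt (mint ν (fun x => A (x, y))) - ∫ x, vnEnt (A (x, y)) ∂ν) := by
    filter_upwards [hvs, ae_slice' hp, hM.slice'] with y h1 h2 h3
    exact holevo h2 h3 h1
  have H3 : ∀ᵐ x ∂ν, Dt (mint μ (fun y => A (x, y))) (mint (ν.prod μ) A) ≤
      ∫⁻ y, Dt (A (x, y)) (mint ν (fun x => A (x, y))) ∂μ := by
    filter_upwards [hM.slice] with x hx
    rw [← hM.marg'.2]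
    exact Dt_mint_le (hm.comp measurable_prodMk_left) (slice_meas' hm) hx hM.marg'.1
  have i1 : Integrable (fun y => ∫ x, vnEnt (A (x, y)) ∂ν) μ := hv.integral_prod_right
  have i2 : Integrable (fun y => vnEnt (mint ν (fun x => A (x, y)))
    - ∫ x, vnEnt (A (x, y)) ∂ν) μ := hv2.sub i1
  have hn : 0 ≤ᵐ[μ] (fun y => vnEnt (mint ν (fun x => A (x, y)))
    - ∫ x, vnEnt (A (x, y)) ∂ν) := by
    filter_upwards [H2] with y hy using sub_nonneg.2 hy.1
  rw [integral_prod_symm _ hv, ← integral_sub hv2 i1,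
    ← ENNReal.ofReal_le_ofReal_iff (integral_nonneg_of_ae hn), ← H1,
    ofReal_integral_eq_lintegral_ofReal i2 hn]
  calc _ ≤ ∫⁻ x, ∫⁻ y, Dt (A (x, y)) (mint ν (fun x => A (x, y))) ∂μ ∂ν := lintegral_mono_ae H3
    _ = ∫⁻ y, ∫⁻ x, Dt (A (x, y)) (mint ν (fun x => A (x, y))) ∂ν ∂μ := by
      apply lintegral_lintegral_swap
      exact (measurable_Dt_comp hm ((slice_meas' hm).comp measurable_snd)).aemeasurable
    _ = _ := by
      apply lintegral_congr_ae
      filter_upwards [H2] with y hy using hy.2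

/-- Conditional version of strong subadditivity. -/
lemma ssa_cond {γ α β : Type*} [MeasurableSpace γ] [MeasurableSpace α] [MeasurableSpace β] {d : ℕ}
    {κ : Measure γ} [SFinite κ] {ν : Measure α}
    {μ : Measure β} [IsProbabilityMeasure ν] [SFinite μ] {A : γ × (α × β) → Mat d}
    (hm : Measurable A) (hp : ∀ᵐ p ∂(κ.prod (ν.prod μ)), (A p).PosSemidef)
    (hM : MInt A (κ.prod (ν.prod μ)))
    (hv : Integrable (fun p => vnEnt (A p)) (κ.prod (ν.prod μ)))
    (hv1 : Integrable (fun q : γ × α => vnEnt (mint μ (fun y => A (q.1, (q.2, y))))) (κ.prod ν))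
    (hv2 : Integrable (fun q : γ × β => vnEnt (mint ν (fun x => A (q.1, (x, q.2))))) (κ.prod μ))
    (hv0 : Integrable (fun c => vnEnt (mint (ν.prod μ) (fun r => A (c, r)))) κ) :
    ∫ c, vnEnt (mint (ν.prod μ) (fun r => A (c, r))) ∂κ
      - ∫ q : γ × α, vnEnt (mint μ (fun y => A (q.1, (q.2, y)))) ∂(κ.prod ν) ≤
      ∫ q : γ × β, vnEnt (mint ν (fun x => A (q.1, (x, q.2)))) ∂(κ.prod μ)
      - ∫ p, vnEnt (A p) ∂(κ.prod (ν.prod μ)) := by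
  rw [integral_prod _ hv1, integral_prod _ hv2, integral_prod _ hv,
    ← integral_sub hv0 hv1.integral_prod_left,
    ← integral_sub hv2.integral_prod_left hv.integral_prod_left]
  apply integral_mono_ae (hv0.sub hv1.integral_prod_left)
    (hv2.integral_prod_left.sub hv.integral_prod_left)
  filter_upwards [ae_slice hp, hM.slice, hv.prod_right_ae, hv1.prod_right_ae, hv2.prod_right_ae]
    with c h1 h2 h3 h4 h5
  exact ssa (A := fun r => A (c, r)) (hm.comp measurable_prodMk_left) h1 h2 h3 h4 h5

lemma neg_mul_log_le {t W : ℝ} (ht : 0 ≤ t) :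
    -(t * Real.log t) ≤ Real.exp (-W) - t + t * W := by
  have := rel_nonneg ht (Real.exp_pos (-W))
  unfold rel at this
  rw [Real.log_exp] at this
  linarith

lemma jensen_int {γ α : Type*} [MeasurableSpace γ] [MeasurableSpace α] {d : ℕ}
    {κ : Measure γ} [SFinite κ] {ν : Measure α} [IsProbabilityMeasure ν] {A : γ × α → Mat d}
    (hm : Measurable A) (hp : ∀ᵐ p ∂(κ.prod ν), (A p).PosSemidef)
    (hM : MInt A (κ.prod ν))
    (hv : Integrable (fun p => vnEnt (A p)) (κ.prod ν)) {W : γ → ℝ}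
    (hW : Integrable (fun c => Real.exp (-W c)) κ)
    (hWt : Integrable (fun c => (mint ν (fun x => A (c, x))).trace.re * W c) κ) :
    Integrable (fun c => vnEnt (mint ν (fun x => A (c, x)))) κ ∧
      ∫ p, vnEnt (A p) ∂(κ.prod ν) ≤ ∫ c, vnEnt (mint ν (fun x => A (c, x))) ∂κ := by
  have hlow : ∀ᵐ c ∂κ, ∫ x, vnEnt (A (c, x)) ∂ν ≤ vnEnt (mint ν (fun x => A (c, x))) := by
    filter_upwards [ae_slice hp, hM.slice, hv.prod_right_ae] with c h1 h2 h3
    exact (holevo h1 h2 h3).1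
  have hi : Integrable (fun c => vnEnt (mint ν (fun x => A (c, x)))) κ := by
    have it : Integrable (fun c => (mint ν (fun x => A (c, x))).trace.re) κ :=
      hM.marg.1.trace_re.1
    refine integrable_of_le_of_le (g₂ := fun c =>
      (mint ν (fun x => A (c, x))).trace.re * Real.log d + (Real.exp (-W c)
      - (mint ν (fun x => A (c, x))).trace.re + (mint ν (fun x => A (c, x))).trace.re * W c))
      (aesm_vnEnt (slice_meas hm) (psd_marg hp hM)) hlow ?_ hv.integral_prod_left
      ((it.mul_const _).add ((hW.sub it).add hWt))
    filter_upwards [psd_marg hp hM] with c hc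
    have h1 := vnEnt_le hc
    have h2 := neg_mul_log_le (W := W c) (psd_trace_nonneg hc)
    linarith
  refine ⟨hi, ?_⟩
  rw [integral_prod _ hv]
  exact integral_mono_ae hv.integral_prod_left hi hlow

lemma gd_pos (n : ℕ) (z : En n) : 0 < gaussDensity n z := by
  unfold gaussDensity; positivity

lemma gd_cont (n : ℕ) : Continuous (gaussDensity n) := by
  unfold gaussDensity; fun_prop

lemma gd_meas (n : ℕ) : Measurable (gaussDensity n) := (gd_cont n).measurable

/-- The standard Gaussian measure. -/
def G (n : ℕ) : Measure (En n) := volume.withDensity (fun z => ENNReal.ofReal (gaussDensity n z))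

lemma gd_integral (n : ℕ) : Integrable (gaussDensity n) ∧ ∫ z, gaussDensity n z = 1 := by
  have h1 := GaussianFourier.integral_rexp_neg_mul_sq_norm (V := En n) (b := 1 / 2) (by norm_num)
  have h2 : (π / (1 / 2)) = 2 * π := by ring
  have hi : ∫ z, gaussDensity n z = 1 := by
    unfold gaussDensity
    rw [integral_const_mul]
    have : ∀ z : En n, -‖z‖ ^ 2 / 2 = -(1 / 2) * ‖z‖ ^ 2 := fun z => by ring
    simp only [this]
    rw [h1, h2, finrank_euclideanSpace_fin, ← Real.rpow_add (by positivity)]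
    rw [neg_div, neg_add_cancel, Real.rpow_zero]
  refine ⟨?_, hi⟩
  by_contra h
  rw [integral_undef h] at hi
  exact zero_ne_one hi

instance G_prob (n : ℕ) : IsProbabilityMeasure (G n) := by
  constructor
  rw [G, withDensity_apply _ MeasurableSet.univ, Measure.restrict_univ,
    ← ofReal_integral_eq_lintegral_ofReal (gd_integral n).1 (ae_of_all _ fun z => (gd_pos n z).le),
    (gd_integral n).2]
  simp

lemma G_integrable {n : ℕ} {E : Type*} [NormedAddCommGroup E] [NormedSpace ℝ E] {f : En n → E} :
    Integrable f (G n) ↔ Integrable (fun z => gaussDensity n z • f z) := by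
  rw [G, integrable_withDensity_iff_integrable_smul' (gd_meas n).ennreal_ofReal
    (ae_of_all _ fun _ => ENNReal.ofReal_lt_top)]
  simp only [ENNReal.toReal_ofReal (gd_pos n _).le]

lemma G_integral {n : ℕ} {E : Type*} [NormedAddCommGroup E] [NormedSpace ℝ E] {f : En n → E} :
    ∫ z, f z ∂(G n) = ∫ z, gaussDensity n z • f z := by
  rw [G, integral_withDensity_eq_integral_toReal_smul (gd_meas n).ennreal_ofReal
    (ae_of_all _ fun _ => ENNReal.ofReal_lt_top)]
  simp only [ENNReal.toReal_ofReal (gd_pos n _).le]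

lemma G_charFun (n : ℕ) (t : En n) : charFun (G n) t = Complex.exp (-‖t‖ ^ 2 / 2) := by
  rw [charFun_apply, G_integral]
  have h1 := GaussianFourier.integral_cexp_neg_mul_sq_norm_add (V := En n) (b := 1 / 2)
    (by norm_num) Complex.I t
  have h2 : ∀ z : En n, gaussDensity n z • Complex.exp (inner ℝ z t * Complex.I)
      = (((2 * π) ^ (-(n : ℝ) / 2) : ℝ) : ℂ) *
        Complex.exp (-(1 / 2) * ‖z‖ ^ 2 + Complex.I * inner ℝ t z) := by
    intro z
    rw [Complex.exp_add, gaussDensity, Complex.real_smul, real_inner_comm]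
    push_cast
    have e1 : (-(‖z‖ : ℂ) ^ 2 / 2) = -(1 / 2) * (‖z‖ : ℂ) ^ 2 := by ring
    have e2 : ((inner ℝ t z : ℝ) : ℂ) * Complex.I = Complex.I * ((inner ℝ t z : ℝ) : ℂ) :=
      mul_comm _ _
    rw [mul_assoc, e1, e2]
  simp only [h2]
  rw [integral_const_mul, h1, finrank_euclideanSpace_fin, ← mul_assoc]
  have h3 : (π / (1 / 2) : ℂ) ^ ((n : ℂ) / 2) = (((2 * π) ^ ((n : ℝ) / 2) : ℝ) : ℂ) := by
    rw [Complex.ofReal_cpow (by positivity)]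
    push_cast
    congr 1; ring
  rw [h3, ← Complex.ofReal_mul, ← Real.rpow_add (by positivity), neg_div, neg_add_cancel,
    Real.rpow_zero, Complex.ofReal_one, one_mul, Complex.I_sq]
  congr 1; ring

lemma G_eq_std (n : ℕ) : G n = ProbabilityTheory.stdGaussian (En n) := by
  apply Measure.ext_of_charFun
  ext t
  rw [G_charFun, ProbabilityTheory.charFun_stdGaussian]

lemma G_sq (n : ℕ) : Integrable (fun z => ‖z‖ ^ 2) (G n) := by
  rw [G_eq_std]
  have := (ProbabilityTheory.IsGaussian.memLp_two_id
    (μ := ProbabilityTheory.stdGaussian (En n)))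
  exact this.integrable_norm_pow (p := 2) (by norm_num)

lemma G_semigroup (n : ℕ) (a b c : ℝ) (h : a ^ 2 + b ^ 2 = c ^ 2) :
    ((G n).prod (G n)).map (fun p => a • p.1 + b • p.2) = (G n).map (c • ·) := by
  have hc : Measurable (fun z : En n => c • z) := by fun_prop
  have ha : Measurable (fun z : En n => a • z) := by fun_prop
  have hb : Measurable (fun z : En n => b • z) := by fun_prop
  have := Measure.isProbabilityMeasure_map (μ := G n) hc.aemeasurable
  have := Measure.isProbabilityMeasure_map (μ := G n) ha.aemeasurable
  have := Measure.isProbabilityMeasure_map (μ := G n) hb.aemeasurable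
  have e : ((G n).prod (G n)).map (fun p => a • p.1 + b • p.2) =
      Measure.conv ((G n).map (a • ·)) ((G n).map (b • ·)) := by
    rw [Measure.conv, Measure.map_prod_map _ _ ha hb, Measure.map_map (by fun_prop) (by fun_prop)]
    rfl
  rw [e]
  apply Measure.ext_of_charFun
  ext t
  rw [charFun_conv, charFun_map_smul, charFun_map_smul, charFun_map_smul, G_charFun, G_charFun,
    G_charFun, ← Complex.exp_add]
  congr 1
  simp only [norm_smul, mul_pow, Complex.ofReal_mul]
  rw [← Complex.ofReal_pow ‖a‖, ← Complex.ofReal_pow ‖b‖, ← Complex.ofReal_pow ‖c‖]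
  simp only [Real.norm_eq_abs, sq_abs]
  rw [← h]; push_cast; ring

instance pairLeftInv (n : ℕ) : (volume : Measure (En n × En n)).IsAddLeftInvariant := by
  rw [Measure.volume_eq_prod]; infer_instance

lemma MeasureTheory.MeasurePreserving.integral_eq {α β E : Type*} [MeasurableSpace α]
    [MeasurableSpace β] [NormedAddCommGroup E] [NormedSpace ℝ E] {μ : Measure α} {ν : Measure β}
    {f : α → β} (h : MeasurePreserving f μ ν) {F : β → E} (hF : Integrable F ν) :
    Integrable (fun a => F (f a)) μ ∧ ∫ a, F (f a) ∂μ = ∫ b, F b ∂ν := by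
  refine ⟨h.integrable_comp_of_integrable hF, ?_⟩
  rw [← h.map_eq, integral_map h.measurable.aemeasurable]
  rw [h.map_eq]; exact hF.1

lemma MInt.comp {α β : Type*} [MeasurableSpace α]
    [MeasurableSpace β] {d : ℕ} {μ : Measure α} {ν : Measure β}
    {f : α → β} (h : MeasurePreserving f μ ν) {F : β → Mat d} (hF : MInt F ν) :
    MInt (fun a => F (f a)) μ ∧ mint μ (fun a => F (f a)) = mint ν F := by
  refine ⟨fun i j => (h.integral_eq (hF i j)).1, ?_⟩
  ext i j
  exact (h.integral_eq (hF i j)).2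

section general
variable {V : Type*} [NormedAddCommGroup V] [MeasureSpace V] [BorelSpace V]
  [SecondCountableTopology V] [SFinite (volume : Measure V)]
  [(volume : Measure V).IsAddLeftInvariant] {d : ℕ}
  {β : Type*} [MeasurableSpace β] {P : Measure β}

/-- The entropy functional of an operator-valued density. -/
def H (ω : V → Mat d) : ℝ := ∫ v, vnEnt (ω v)

/-- Well-behaved operator-valued densities. -/
structure Good (ω : V → Mat d) : Prop where
  meas : Measurable ω
  psd : ∀ x, (ω x).PosSemidef
  mi : MInt ω volume
  sq : Integrable (fun x => (ω x).trace.re * ‖x‖ ^ 2)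
  ent : Integrable (fun x => vnEnt (ω x))

lemma shear_mp [SFinite P] {f : β → V} (hf : Measurable f) :
    MeasurePreserving (fun p : V × β => (p.1 - f p.2, p.2)) ((volume : Measure V).prod P)
      ((volume : Measure V).prod P) := by
  have h1 : MeasurePreserving (fun p : β × V => (p.1, p.2 - f p.1)) (P.prod (volume : Measure V))
      (P.prod (volume : Measure V)) := by
    apply MeasurePreserving.skew_product (MeasurePreserving.id P) (g := fun b v => v - f b)
    · exact (measurable_snd.sub (hf.comp measurable_fst))
    · refine ae_of_all _ fun b => ?_
      have : (fun v : V => v - f b) = fun v => -f b + v := by funext v; abel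
      rw [this]
      exact map_add_left_eq_self _ _
  exact (Measure.measurePreserving_swap.comp h1).comp Measure.measurePreserving_swap

lemma shift_int [IsProbabilityMeasure P] {f : β → V} (hf : Measurable f) {E : Type*}
    [NormedAddCommGroup E] [NormedSpace ℝ E] {F : V → E} (hF : Integrable F) :
    Integrable (fun p : V × β => F (p.1 - f p.2)) ((volume : Measure V).prod P) ∧
    ∫ p : V × β, F (p.1 - f p.2) ∂((volume : Measure V).prod P) = ∫ v, F v := by
  have h := (shear_mp (P := P) hf).integral_eq (hF.comp_fst P)
  refine ⟨h.1, h.2.trans ?_⟩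
  rw [integral_fun_fst]; simp

/-- Convolution with a random shift. -/
def nconv (P : Measure β) (f : β → V) (ω : V → Mat d) : V → Mat d :=
  fun v => mint P (fun b => ω (v - f b))

lemma shift_mint [IsProbabilityMeasure P] {f : β → V} (hf : Measurable f) {ω : V → Mat d}
    (hω : MInt ω volume) :
    MInt (fun p : V × β => ω (p.1 - f p.2)) ((volume : Measure V).prod P) :=
  fun i j => (shift_int hf (hω i j)).1

lemma shift_meas {f : β → V} (hf : Measurable f) {ω : V → Mat d} (h : Measurable ω) :
    Measurable (fun p : V × β => ω (p.1 - f p.2)) :=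
  h.comp (measurable_fst.sub (hf.comp measurable_snd))

lemma nconv_sq [IsProbabilityMeasure P] {f : β → V} (hf : Measurable f)
    (hf2 : Integrable (fun b => ‖f b‖ ^ 2) P) {ω : V → Mat d} (hω : Good ω) :
    Integrable (fun v => (nconv P f ω v).trace.re * ‖v‖ ^ 2) := by
  have hmt : Measurable (fun A : Mat d => A.trace.re) :=
    (Complex.continuous_re.comp (Continuous.matrix_trace continuous_id)).measurable
  have h0 : Integrable (fun p : V × β => (ω p.1).trace.re * ‖p.1 + f p.2‖ ^ 2)
      ((volume : Measure V).prod P) := by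
    have h1 : Integrable (fun p : V × β => 2 * ((ω p.1).trace.re * ‖p.1‖ ^ 2)
        + 2 * ((ω p.1).trace.re * ‖f p.2‖ ^ 2)) ((volume : Measure V).prod P) :=
      ((hω.sq.comp_fst P).const_mul 2).add ((hω.mi.trace_re.1.mul_prod hf2).const_mul 2)
    refine h1.mono' ?_ (ae_of_all _ fun p => ?_)
    · exact ((hmt.comp (hω.meas.comp measurable_fst)).mul
        ((measurable_fst.add (hf.comp measurable_snd)).norm.pow_const 2)).aestronglyMeasurable
    · have ht := psd_trace_nonneg (hω.psd p.1)
      rw [Real.norm_of_nonneg (by positivity)]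
      have := norm_add_le p.1 (f p.2)
      have h3 : ‖p.1 + f p.2‖ ^ 2 ≤ 2 * ‖p.1‖ ^ 2 + 2 * ‖f p.2‖ ^ 2 := by
        nlinarith [norm_nonneg (p.1 + f p.2), sq_nonneg (‖p.1‖ - ‖f p.2‖)]
      nlinarith
  have h1 := ((shear_mp (P := P) hf).integral_eq h0).1
  simp only [sub_add_cancel] at h1
  refine h1.integral_prod_left.congr ?_
  filter_upwards [(shift_mint (P := P) hf hω.mi).slice] with v hv
  rw [integral_mul_const, hv.trace_re.2]
  rfl

lemma nconv_ent [IsProbabilityMeasure P] (hexp : Integrable (fun v : V => Real.exp (-‖v‖ ^ 2)))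
    {f : β → V} (hf : Measurable f)
    (hf2 : Integrable (fun b => ‖f b‖ ^ 2) P) {ω : V → Mat d} (hω : Good ω) :
    Integrable (fun v => vnEnt (nconv P f ω v)) ∧ H ω ≤ H (nconv P f ω) := by
  have h := jensen_int (ν := P) (shift_meas hf hω.meas) (ae_of_all _ fun p => hω.psd _)
    (shift_mint hf hω.mi) (shift_int hf hω.ent).1 (W := fun v => ‖v‖ ^ 2) hexp
    (nconv_sq hf hf2 hω)
  rw [(shift_int (P := P) hf hω.ent).2] at h
  exact h

end general

lemma hexpE (n : ℕ) : Integrable (fun v : En n => Real.exp (-‖v‖ ^ 2)) := by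
  have h := (gd_integral n).1
  unfold gaussDensity at h
  have h2 : Integrable (fun z : En n => Real.exp (-‖z‖ ^ 2 / 2)) := by
    refine (h.const_mul ((2 * π) ^ (-(n : ℝ) / 2))⁻¹).congr (ae_of_all _ fun z => ?_)
    have : (2 * π) ^ (-(n : ℝ) / 2) ≠ 0 := by positivity
    field_simp
  refine h2.mono' (Continuous.aestronglyMeasurable (by fun_prop)) (ae_of_all _ fun v => ?_)
  rw [Real.norm_of_nonneg (Real.exp_pos _).le]
  apply Real.exp_le_exp.2
  nlinarith [sq_nonneg ‖v‖]

lemma hexpP (n : ℕ) : Integrable (fun v : En n × En n => Real.exp (-‖v‖ ^ 2)) := by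
  have h := (gd_integral n).1
  unfold gaussDensity at h
  have h2 : Integrable (fun z : En n => Real.exp (-‖z‖ ^ 2 / 2)) := by
    refine (h.const_mul ((2 * π) ^ (-(n : ℝ) / 2))⁻¹).congr (ae_of_all _ fun z => ?_)
    have : (2 * π) ^ (-(n : ℝ) / 2) ≠ 0 := by positivity
    field_simp
  have h3 := h2.mul_prod h2
  rw [Measure.volume_eq_prod]
  refine h3.mono' (Continuous.aestronglyMeasurable (by fun_prop)) (ae_of_all _ fun v => ?_)
  rw [Real.norm_of_nonneg (Real.exp_pos _).le, ← Real.exp_add]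
  apply Real.exp_le_exp.2
  have h1 := norm_fst_le v
  have h2 := norm_snd_le v
  nlinarith [norm_nonneg v.1, norm_nonneg v.2]

lemma fekete {φ : ℝ → ℝ} (h0 : ∀ t, 0 < t → 0 ≤ φ t)
    (hsub : ∀ s t, 0 < s → 0 < t → φ (s + t) ≤ φ s + φ t) {ε C : ℝ} (hε : 0 < ε)
    (hC : ∀ t, 0 < t → t < ε → φ t ≤ C * t) :
    ∃ L, Tendsto (fun t => φ t / t) (𝓝[>] 0) (𝓝 L) ∧ ∀ s, 0 < s → φ s / s ≤ L := by
  have hmul : ∀ (k : ℕ) (t r : ℝ), 0 < t → 0 < r → φ (k * t + r) ≤ k * φ t + φ r := by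
    intro k t r ht hr
    induction k with
    | zero => simp
    | succ k ih =>
      have h1 := hsub t (k * t + r) ht (by positivity)
      have e : ((k + 1 : ℕ) : ℝ) * t + r = t + (k * t + r) := by push_cast; ring
      rw [e]; push_cast; linarith
  have key : ∀ s t, 0 < s → 0 < t → t < ε → φ s / s ≤ φ t / t + C * t / s := by
    intro s t hs ht hte
    obtain ⟨k, hk⟩ : ∃ k : ℕ, (k : ℝ) * t < s ∧ s ≤ (k + 1) * t := by
      have h1 : 0 < s / t := by positivity
      have h2 : 0 < ⌈s / t⌉₊ := Nat.ceil_pos.2 h1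
      refine ⟨⌈s / t⌉₊ - 1, ?_, ?_⟩
      · have := Nat.ceil_lt_add_one h1.le
        rw [Nat.cast_sub h2, Nat.cast_one]
        have h3 : (⌈s / t⌉₊ : ℝ) - 1 < s / t := by linarith
        exact (lt_div_iff₀ ht).1 h3
      · rw [Nat.cast_sub h2, Nat.cast_one, sub_add_cancel]
        exact (div_le_iff₀ ht).1 (Nat.le_ceil _)
    have hr : 0 < s - k * t := by linarith [hk.1]
    have h1 := hmul k t (s - k * t) ht hr
    rw [add_sub_cancel] at h1
    have hC0 : 0 ≤ C := by
      have h2 := (h0 t ht).trans (hC t ht hte)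
      by_contra hneg
      push Not at hneg
      nlinarith
    have h2 : φ (s - k * t) ≤ C * t := by
      rcases (show s - k * t ≤ t by linarith [hk.2]).lt_or_eq with h | h
      · refine (hC _ hr (by linarith)).trans ?_
        exact mul_le_mul_of_nonneg_left h.le hC0
      · rw [h]; exact hC t ht hte
    have h3 : (k : ℝ) * φ t ≤ s * (φ t / t) := by
      have : (k : ℝ) ≤ s / t := by rw [le_div_iff₀ ht]; exact hk.1.le
      calc (k : ℝ) * φ t ≤ s / t * φ t := mul_le_mul_of_nonneg_right this (h0 t ht)
        _ = _ := by ring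
    rw [div_le_iff₀ hs]
    have : (φ t / t + C * t / s) * s = s * (φ t / t) + C * t := by field_simp
    rw [this]; linarith
  set S : Set ℝ := (fun t => φ t / t) '' Set.Ioo 0 ε with hS
  have hbdd : BddAbove S := by
    refine ⟨C, ?_⟩
    rintro _ ⟨t, ht, rfl⟩
    exact (div_le_iff₀ ht.1).2 (hC t ht.1 ht.2)
  have hne : S.Nonempty := ⟨_, ε / 2, ⟨by linarith, by linarith⟩, rfl⟩
  have hev : ∀ᶠ t in 𝓝[>] (0 : ℝ), t ∈ Set.Ioo 0 ε := Ioo_mem_nhdsGT hε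
  have hT : Tendsto (fun t => φ t / t) (𝓝[>] 0) (𝓝 (sSup S)) := by
    rw [tendsto_order]
    constructor
    · intro a ha
      obtain ⟨_, ⟨s, hs, rfl⟩, hlt⟩ := exists_lt_of_lt_csSup hne ha
      have h1 : Tendsto (fun t : ℝ => φ s / s - C * t / s) (𝓝[>] 0) (𝓝 (φ s / s - C * 0 / s)) := by
        refine Tendsto.mono_left ?_ nhdsWithin_le_nhds
        exact (Continuous.tendsto (by fun_prop) 0)
      rw [mul_zero, zero_div, sub_zero] at h1
      filter_upwards [hev, h1.eventually (lt_mem_nhds hlt)] with t ht h2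
      have := key s t hs.1 ht.1 ht.2
      linarith
    · intro a ha
      filter_upwards [hev] with t ht
      exact (le_csSup hbdd ⟨t, ht, rfl⟩).trans_lt ha
  refine ⟨_, hT, fun s hs => ?_⟩
  have h1 : Tendsto (fun t : ℝ => φ t / t + C * t / s) (𝓝[>] 0) (𝓝 (sSup S + C * 0 / s)) := by
    refine hT.add (Tendsto.mono_left ?_ nhdsWithin_le_nhds)
    exact (Continuous.tendsto (by fun_prop) 0)
  rw [mul_zero, zero_div, add_zero] at h1
  refine ge_of_tendsto h1 ?_
  filter_upwards [hev] with t ht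
  exact key s t hs ht.1 ht.2

section conv
variable {n d : ℕ}

/-- Gaussian convolution. -/
def gconv (c : ℝ) (ω : En n → Mat d) : En n → Mat d := nconv (G n) (fun z => c • z) ω

lemma smul_meas (c : ℝ) : Measurable (fun z : En n => c • z) := by fun_prop

lemma smul_sq (c : ℝ) : Integrable (fun z : En n => ‖c • z‖ ^ 2) (G n) := by
  simp only [norm_smul, mul_pow]
  exact (G_sq n).const_mul _

lemma gconv_ent (c : ℝ) {ω : En n → Mat d} (hω : Good ω) :
    Integrable (fun v => vnEnt (gconv c ω v)) ∧ H ω ≤ H (gconv c ω) :=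
  nconv_ent (hexpE n) (smul_meas c) (smul_sq c) hω

lemma gconv_semigroup {a b c : ℝ} (h : a ^ 2 + b ^ 2 = c ^ 2) {ω : En n → Mat d}
    (hω : Measurable ω) (w : En n) :
    mint ((G n).prod (G n)) (fun r => ω (w - (a • r.1 + b • r.2))) = gconv c ω w := by
  ext i j
  simp only [mint, gconv, nconv, Matrix.of_apply]
  have hm : Measurable (fun v => ω (w - v) i j) :=
    (measurable_entry i j).comp (hω.comp (measurable_const.sub measurable_id))
  have e1 := integral_map (μ := (G n).prod (G n)) (φ := fun p => a • p.1 + b • p.2)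
    (f := fun v => ω (w - v) i j) (by fun_prop) hm.aestronglyMeasurable
  have e2 := integral_map (μ := G n) (φ := fun z => c • z)
    (f := fun v => ω (w - v) i j) (by fun_prop) hm.aestronglyMeasurable
  rw [← e1, ← e2, G_semigroup n a b c h]

lemma gconv_subadd {a b c : ℝ} (h : a ^ 2 + b ^ 2 = c ^ 2) {ω : En n → Mat d} (hω : Good ω) :
    H (gconv c ω) - H (gconv b ω) ≤ H (gconv a ω) - H ω := by
  have hf : Measurable (fun r : En n × En n => a • r.1 + b • r.2) := by fun_prop
  set A : En n × (En n × En n) → Mat d := fun p => ω (p.1 - (a • p.2.1 + b • p.2.2)) with hA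
  have e1 : ∀ q : En n × En n, mint (G n) (fun y => A (q.1, (q.2, y)))
      = gconv b ω (q.1 - a • q.2) := by
    intro q
    simp only [hA, gconv, nconv, sub_sub]
  have e2 : ∀ q : En n × En n, mint (G n) (fun x => A (q.1, (x, q.2)))
      = gconv a ω (q.1 - b • q.2) := by
    intro q
    simp only [hA, gconv, nconv]
    congr 1; funext x; congr 1; abel
  have e0 : ∀ w, mint ((G n).prod (G n)) (fun r => A (w, r)) = gconv c ω w := fun w =>
    gconv_semigroup h hω.meas w
  have s := shift_int (P := (G n).prod (G n)) hf hω.ent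
  have s1 := shift_int (P := G n) (smul_meas a) (gconv_ent b hω).1
  have s2 := shift_int (P := G n) (smul_meas b) (gconv_ent a hω).1
  have := ssa_cond (κ := (volume : Measure (En n))) (ν := G n) (μ := G n) (A := A)
    (shift_meas hf hω.meas) (ae_of_all _ fun p => hω.psd _) (shift_mint hf hω.mi) s.1
    (by simp only [e1]; exact s1.1) (by simp only [e2]; exact s2.1)
    (by simp only [e0]; exact (gconv_ent c hω).1)
  simp only [e0, e1, e2] at this
  rw [s1.2, s2.2, s.2] at this
  exact this

lemma gconv_trace_le {c : ℝ} (hc : 0 < c) {ω : En n → Mat d} (hω : Good ω)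
    (h1 : ∫ v, (ω v).trace.re = 1) :
    ∀ᵐ w, (gconv c ω w).trace.re ≤ (2 * π) ^ (-(n : ℝ) / 2) * (c ^ n)⁻¹ := by
  filter_upwards [(shift_mint (P := G n) (smul_meas c) hω.mi).slice] with w hw
  have e : (gconv c ω w).trace.re = ∫ z, gaussDensity n z * (ω (w - c • z)).trace.re := by
    rw [gconv, nconv, ← hw.trace_re.2, G_integral]
    rfl
  rw [e]
  set F : En n → ℝ := fun u => gaussDensity n (c⁻¹ • u) * (ω (w - u)).trace.re with hF
  have e2 : ∀ z, gaussDensity n z * (ω (w - c • z)).trace.re = F (c • z) := by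
    intro z
    simp only [hF, smul_smul, inv_mul_cancel₀ hc.ne', one_smul]
  simp only [e2]
  rw [Measure.integral_comp_smul, finrank_euclideanSpace_fin, smul_eq_mul, mul_comm,
    abs_of_nonneg (by positivity)]
  refine mul_le_mul_of_nonneg_right ?_ (by positivity)
  have hi : Integrable (fun u => (ω (w - u)).trace.re) := hω.mi.trace_re.1.comp_sub_left w
  calc ∫ u, F u ≤ ∫ u, (2 * π) ^ (-(n : ℝ) / 2) * (ω (w - u)).trace.re := by
        apply integral_mono_of_nonneg
        · exact ae_of_all _ fun u => mul_nonneg (gd_pos n _).le (psd_trace_nonneg (hω.psd _))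
        · exact hi.const_mul _
        · refine ae_of_all _ fun u => ?_
          refine mul_le_mul_of_nonneg_right ?_ (psd_trace_nonneg (hω.psd _))
          unfold gaussDensity
          refine mul_le_of_le_one_right (by positivity) (Real.exp_le_one_iff.2 ?_)
          have := sq_nonneg ‖c⁻¹ • u‖
          linarith
    _ = _ := by
        rw [integral_const_mul, integral_sub_left_eq_self (fun u => (ω u).trace.re), h1, mul_one]

lemma gconv_trace {c : ℝ} {ω : En n → Mat d} (hω : Good ω) :
    Integrable (fun w => (gconv c ω w).trace.re) ∧
    ∫ w, (gconv c ω w).trace.re = ∫ v, (ω v).trace.re := by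
  have h := (shift_mint (P := G n) (smul_meas c) hω.mi)
  refine ⟨h.marg.1.trace_re.1, ?_⟩
  have e := h.marg.1.trace_re.2
  rw [h.marg.2, ← h.trace_re.2, (shift_int (smul_meas c) hω.mi.trace_re.1).2] at e
  exact e

lemma gconv_psd (c : ℝ) {ω : En n → Mat d} (hω : Good ω) :
    ∀ᵐ w, (gconv c ω w).PosSemidef :=
  psd_marg (A := fun p : En n × En n => ω (p.1 - c • p.2))
    (ae_of_all _ fun p => hω.psd _) (shift_mint (P := G n) (smul_meas c) hω.mi)

lemma H_ge_of_trace_le {A : En n → Mat d} {K L : ℝ} (hp : ∀ᵐ w, (A w).PosSemidef)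
    (ht : Integrable (fun w => (A w).trace.re)) (hA : Integrable (fun w => vnEnt (A w)))
    (hK : ∀ᵐ w, (A w).trace.re ≤ K) (hL : Real.log K ≤ -L) :
    (∫ w, (A w).trace.re) * L ≤ H A := by
  rw [← integral_mul_const, H]
  refine integral_mono_ae (ht.mul_const _) hA ?_
  filter_upwards [hp, hK] with w hw hle
  refine le_trans ?_ (vnEnt_ge hw)
  have h0 := psd_trace_nonneg hw
  rcases h0.eq_or_lt with h | h
  · rw [← h]; simp
  · have := Real.log_le_log h hle
    nlinarith

lemma log_K_le (hn : 0 < n) {a : ℝ} (a3 : 0 ≤ a) :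
    Real.log ((2 * π) ^ (-(n : ℝ) / 2) * ((Real.exp (a + 1)) ^ n)⁻¹) ≤ -(a + 1) := by
  rw [Real.log_mul (by positivity) (by positivity), Real.log_rpow (by positivity),
    Real.log_inv, Real.log_pow, Real.log_exp]
  have a1 : 0 ≤ Real.log (2 * π) := Real.log_nonneg (by nlinarith [Real.pi_gt_three])
  have a2 : (1 : ℝ) ≤ n := by exact_mod_cast hn
  have a4 : 0 ≤ (n : ℝ) / 2 * Real.log (2 * π) := by positivity
  have a5 : a + 1 ≤ n * (a + 1) := by nlinarith
  have a6 : -(n : ℝ) / 2 * Real.log (2 * π) = -((n : ℝ) / 2 * Real.log (2 * π)) := by ring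
  linarith

lemma exists_gconv_lt (hn : 0 < n) {ω : En n → Mat d} (hω : Good ω)
    (h1 : ∫ v, (ω v).trace.re = 1) : ∃ c, 0 < c ∧ H ω < H (gconv c ω) := by
  refine ⟨Real.exp (|H ω| + 1), Real.exp_pos _, ?_⟩
  have ht := gconv_trace (c := Real.exp (|H ω| + 1)) hω
  have h2 := H_ge_of_trace_le (gconv_psd (Real.exp (|H ω| + 1)) hω) ht.1 (gconv_ent _ hω).1
    (gconv_trace_le (Real.exp_pos _) hω h1) (log_K_le hn (abs_nonneg (H ω)))
  rw [ht.2, h1, one_mul] at h2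
  linarith [le_abs_self (H ω)]

end conv

lemma meas_tr {d : ℕ} : Measurable (fun A : Mat d => A.trace.re) :=
  (Complex.continuous_re.comp (Continuous.matrix_trace continuous_id)).measurable

lemma vnEnt_norm {d : ℕ} {A B : Mat d} {q : ℝ} (hA : A.PosSemidef) (hq : q = A.trace.re)
    (hB : q ≠ 0 → B = ((q : ℂ))⁻¹ • A) : q * vnEnt B = vnEnt A + q * Real.log q := by
  by_cases h : q = 0
  · have := psd_trace_zero hA (hq ▸ h)
    rw [h, this, vnEnt_zero]; simp
  · rw [hB h, ← Complex.ofReal_inv, vnEnt_smul hA.1, ← hq, Real.log_inv]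
    field_simp
    ring

section ce
variable {α : Type*} [MeasureSpace α] {d : ℕ} {q : α → ℝ} {σ Ω : α → Mat d}

lemma ent_of_entFinite (hp : ∀ᵐ a, (Ω a).PosSemidef) (hq : ∀ᵐ a, q a = (Ω a).trace.re)
    (hσ : ∀ᵐ a, q a ≠ 0 → σ a = ((q a : ℂ))⁻¹ • Ω a) (h : EntFinite q σ) :
    Integrable (fun a => vnEnt (Ω a)) := by
  refine (h.2.sub h.1).congr ?_
  filter_upwards [hp, hq, hσ] with a h1 h2 h3
  have := vnEnt_norm h1 h2 h3
  simp only [Pi.sub_apply]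
  linarith

lemma condEnt_eq' (hp : ∀ᵐ a, (Ω a).PosSemidef) (hq : ∀ᵐ a, q a = (Ω a).trace.re)
    (hσ : ∀ᵐ a, q a ≠ 0 → σ a = ((q a : ℂ))⁻¹ • Ω a) (hM : MInt Ω volume)
    (hv : Integrable (fun a => vnEnt (Ω a))) :
    condEnt q σ = (∫ a, vnEnt (Ω a)) - vnEnt (mint volume Ω) := by
  have hqi : Integrable q := hM.trace_re.1.congr (by filter_upwards [hq] with a h using h.symm)
  have hql : AEStronglyMeasurable (fun a => q a * Real.log (q a)) volume :=
    (Real.continuous_mul_log.measurable.comp_aemeasurable hqi.aemeasurable).aestronglyMeasurable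
  have e1 : ∀ᵐ a, q a * vnEnt (σ a) = vnEnt (Ω a) + q a * Real.log (q a) := by
    filter_upwards [hp, hq, hσ] with a h1 h2 h3 using vnEnt_norm h1 h2 h3
  have hqv : Integrable (fun a => q a * vnEnt (σ a)) := by
    refine integrable_of_le_of_le ((hv.1.add hql).congr ?_) (g₁ := fun _ => (0:ℝ))
      (g₂ := fun a => q a * Real.log d) ?_ ?_ (integrable_zero _ _ _) (hqi.mul_const _)
    · filter_upwards [e1] with a h using h.symm
    · filter_upwards [e1, hp, hq] with a h h1 h2
      have := vnEnt_ge h1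
      rw [← h2] at this
      rw [h]; linarith
    · filter_upwards [e1, hp, hq] with a h h1 h2
      have := vnEnt_le h1
      rw [← h2] at this
      rw [h]; linarith
  have hqq : Integrable (fun a => q a * Real.log (q a)) := by
    refine (hqv.sub hv).congr ?_
    filter_upwards [e1] with a h
    simp only [Pi.sub_apply]; linarith
  have e2 : avgState q σ = mint volume Ω := by
    ext i j
    simp only [avgState, mint, Matrix.of_apply]
    apply integral_congr_ae
    filter_upwards [hp, hq, hσ] with a h1 h2 h3
    by_cases h : q a = 0
    · have := psd_trace_zero h1 (h2 ▸ h)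
      rw [h, this]; simp
    · rw [h3 h]
      have : (q a : ℂ) ≠ 0 := by exact_mod_cast h
      simp [Matrix.smul_apply]
      field_simp
  rw [condEnt, e2, clEnt, integral_congr_ae e1, integral_add hv hqq]
  ring

end ce

/-- The standing relation between a density/state pair and its operator density. -/
structure OpRep {n d : ℕ} (q : En n → ℝ) (σ ω : En n → Mat d) : Prop where
  good : Good ω
  tr : ∀ x, q x = (ω x).trace.re
  st : ∀ x, q x ≠ 0 → σ x = ((q x : ℂ))⁻¹ • ω x
  one : ∫ x, (ω x).trace.re = 1

lemma gd_mul_log (n : ℕ) : Integrable (fun z : En n => gaussDensity n z * Real.log (gaussDensity n z)) := by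
  have h1 := (gd_integral n).1.mul_const (Real.log ((2 * π) ^ (-(n : ℝ) / 2)))
  have h2 : Integrable (fun z : En n => gaussDensity n z • ‖z‖ ^ 2) :=
    G_integrable.1 (G_sq n)
  refine (h1.sub (h2.div_const 2)).congr (ae_of_all _ fun z => ?_)
  simp only [Pi.sub_apply, smul_eq_mul]
  have : Real.log (gaussDensity n z) = Real.log ((2 * π) ^ (-(n : ℝ) / 2)) - ‖z‖ ^ 2 / 2 := by
    rw [gaussDensity, Real.log_mul (by positivity) (by positivity), Real.log_exp]; ring
  rw [this]; ring

lemma noisyMI_eq {n d : ℕ} {q : En n → ℝ} {σ ω : En n → Mat d} (h : OpRep q σ ω) (c : ℝ) :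
    noisyMI c q σ = H (gconv c ω) - H ω := by
  set Ω : En n × En n → Mat d := fun p => (gaussDensity n p.2 : ℂ) • ω (p.1 - c • p.2) with hΩ
  set Ω₀ : En n × En n → Mat d := fun p => (gaussDensity n p.2 : ℂ) • ω p.1 with hΩ₀
  have hg0 := fun z => gd_pos n z
  have hp₀ : ∀ p, (Ω₀ p).PosSemidef := fun p =>
    (h.good.psd _).smul (by exact_mod_cast (hg0 p.2).le)
  have hp : ∀ p, (Ω p).PosSemidef := fun p =>
    (h.good.psd _).smul (by exact_mod_cast (hg0 p.2).le)
  have hmp := shear_mp (V := En n) (P := (volume : Measure (En n))) (smul_meas (n := n) c)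
  have hM₀ : MInt Ω₀ ((volume : Measure (En n)).prod volume) := by
    intro i j
    have := (h.good.mi i j).mul_prod ((gd_integral n).1.ofReal (𝕜 := ℂ))
    refine this.congr (ae_of_all _ fun p => ?_)
    simp [hΩ₀, mul_comm]
  have hM := MInt.comp hmp hM₀
  have eV : ∀ p, vnEnt (Ω₀ p) = vnEnt (ω p.1) * gaussDensity n p.2
      - (ω p.1).trace.re * (gaussDensity n p.2 * Real.log (gaussDensity n p.2)) := by
    intro p
    rw [hΩ₀]; simp only
    rw [vnEnt_smul (h.good.psd _).1]; ring
  have i1 := h.good.ent.mul_prod (gd_integral n).1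
  have i2 := h.good.mi.trace_re.1.mul_prod (gd_mul_log n)
  have hv₀ : Integrable (fun p => vnEnt (Ω₀ p)) ((volume : Measure (En n)).prod volume) := by
    refine (i1.sub i2).congr (ae_of_all _ fun p => ?_)
    exact (eV p).symm
  have hv0 : ∫ p, vnEnt (Ω₀ p) ∂((volume : Measure (En n)).prod volume) = H ω
      - ∫ z, gaussDensity n z * Real.log (gaussDensity n z) := by
    simp only [eV]
    rw [integral_sub i1 i2, integral_prod_mul (fun x => vnEnt (ω x)) (gaussDensity n),
      integral_prod_mul (fun x => (ω x).trace.re)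
        (fun z => gaussDensity n z * Real.log (gaussDensity n z)), (gd_integral n).2, h.one, H]
    ring
  have hv := hmp.integral_eq hv₀
  set M := mint volume ω with hMdef
  have hMp : M.PosSemidef := psd_mint (ae_of_all _ h.good.psd) h.good.mi
  have hMt : M.trace.re = 1 := by rw [hMdef, ← h.good.mi.trace_re.2, h.one]
  have hMM : mint ((volume : Measure (En n)).prod volume) Ω₀ = M := by
    ext i j
    simp only [mint, Matrix.of_apply, hMdef, hΩ₀, Matrix.smul_apply, smul_eq_mul]
    have := integral_prod_mul (μ := (volume : Measure (En n))) (ν := (volume : Measure (En n)))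
      (fun x => ω x i j) (fun z => (gaussDensity n z : ℂ))
    rw [integral_complex_ofReal, (gd_integral n).2, Complex.ofReal_one, mul_one] at this
    refine Eq.trans ?_ this
    congr 1; funext p; exact mul_comm _ _
  have hΩe : (fun a : En n × En n => Ω₀ (a.1 - c • a.2, a.2)) = Ω := rfl
  -- joint
  have c0 : condEnt (noisyDensity c q) (noisyState c σ) = (H ω
      - ∫ z, gaussDensity n z * Real.log (gaussDensity n z)) - vnEnt M := by
    rw [condEnt_eq' (Ω := Ω) (ae_of_all _ hp)]
    · rw [← hv0, ← hMM, ← hv.2, ← hM.2]; rfl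
    · refine ae_of_all _ fun p => ?_
      simp [noisyDensity, hΩ, h.tr]
    · refine ae_of_all _ fun p hp => ?_
      simp only [noisyDensity, noisyState, hΩ] at hp ⊢
      have hq := right_ne_zero_of_mul hp
      have : (gaussDensity n p.2 : ℂ) ≠ 0 := by exact_mod_cast (hg0 _).ne'
      rw [h.st _ hq, smul_smul]
      congr 1
      push_cast
      field_simp
    · exact hM.1
    · exact hv.1
  -- first marginal
  have m1 : ∀ w, mint volume (fun z => Ω (w, z)) = gconv c ω w := by
    intro w
    ext i j
    simp only [mint, gconv, nconv, Matrix.of_apply, hΩ]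
    rw [G_integral]; rfl
  have t1 : ∀ᵐ w, margFst (noisyDensity c q) w = (gconv c ω w).trace.re := by
    filter_upwards [hM.1.slice] with w hw
    have := hw.trace_re.2
    rw [← m1]
    refine Eq.trans ?_ this
    apply integral_congr_ae
    refine ae_of_all _ fun z => ?_
    simp [noisyDensity, hΩ₀, h.tr]
  have ofe : ∀ x z, (noisyDensity c q (x, z) : ℂ) • noisyState c σ (x, z) = Ω (x, z) := by
    intro x z
    simp only [noisyDensity, noisyState, hΩ]
    by_cases hq : q (x - c • z) = 0
    · have := psd_trace_zero (h.good.psd (x - c • z)) (by rw [← h.tr, hq])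
      rw [hq, this]; simp
    · rw [h.st _ hq, smul_smul]
      have : (q (x - c • z) : ℂ) ≠ 0 := by exact_mod_cast hq
      push_cast
      congr 1
      field_simp
  have c1 : condEnt (margFst (noisyDensity c q)) (margFstState (noisyDensity c q) (noisyState c σ))
      = H (gconv c ω) - vnEnt M := by
    rw [condEnt_eq' (Ω := gconv c ω) (gconv_psd c h.good) t1]
    · rw [← hMM, ← hM.2, H]
      congr 2
      rw [← hM.1.marg.2]
      congr 1
      funext w; exact (m1 w).symm
    · refine ae_of_all _ fun w _ => ?_
      rw [margFstState, ← m1]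
      congr 1
      ext i j
      simp only [mint, Matrix.of_apply]
      congr 1
      funext z
      rw [← ofe]; rfl
    · have := hM.1.marg.1
      have e : (fun w => mint volume (fun z => Ω (w, z))) = gconv c ω := funext m1
      rw [← e]; exact this
    · exact (gconv_ent c h.good).1
  -- second marginal
  have m2 : ∀ z, mint volume (fun w => Ω (w, z)) = (gaussDensity n z : ℂ) • M := by
    intro z
    ext i j
    simp only [mint, Matrix.of_apply, hΩ, Matrix.smul_apply, smul_eq_mul, hMdef]
    rw [integral_const_mul, integral_sub_right_eq_self (fun w => ω w i j)]
  have c2 : condEnt (margSnd (noisyDensity c q)) (margSndState (noisyDensity c q) (noisyState c σ))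
      = - (∫ z, gaussDensity n z * Real.log (gaussDensity n z)) := by
    have ev : ∀ z, vnEnt ((gaussDensity n z : ℂ) • M) = gaussDensity n z * vnEnt M
        - gaussDensity n z * Real.log (gaussDensity n z) := by
      intro z; rw [vnEnt_smul hMp.1, hMt, mul_one]
    have iv1 : Integrable (fun z => gaussDensity n z * vnEnt M) := (gd_integral n).1.mul_const _
    rw [condEnt_eq' (Ω := fun z => (gaussDensity n z : ℂ) • M)]
    · have : mint volume (fun z => (gaussDensity n z : ℂ) • M) = M := by
        have e : (fun z => (gaussDensity n z : ℂ) • M) = fun z => mint volume (fun w => Ω (w, z)) :=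
          funext fun z => (m2 z).symm
        rw [e, ← hMM, ← hM.2]
        exact hM.1.marg'.2
      rw [this]
      simp only [ev]
      rw [integral_sub iv1 (gd_mul_log n), integral_mul_const, (gd_integral n).2]; ring
    · exact ae_of_all _ fun z => hMp.smul (by exact_mod_cast (hg0 z).le)
    · refine ae_of_all _ fun z => ?_
      simp only [margSnd, noisyDensity, h.tr]
      rw [integral_const_mul, integral_sub_right_eq_self (fun w => (ω w).trace.re), h.one]
      simp [hMt]
    · refine ae_of_all _ fun z _ => ?_
      rw [margSndState, ← m2]
      congr 1
      ext i j
      simp only [mint, Matrix.of_apply]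
      congr 1
      funext w
      rw [← ofe]; rfl
    · intro i j
      exact (gd_integral n).1.ofReal.mul_const _
    · simp only [ev]; exact iv1.sub (gd_mul_log n)
  rw [noisyMI, condMI, c0, c1, c2]
  ring

lemma state_smul_trace {d : ℕ} {A : Mat d} (h : IsState A) (c : ℝ) :
    ((c : ℂ) • A).trace.re = c := by
  rw [Matrix.trace_smul, h.2]; simp

lemma smul_mat_meas {α : Type*} [MeasurableSpace α] {d : ℕ} {p : α → ℝ} {ρ : α → Mat d}
    (hp : Measurable p) (hρ : Measurable ρ) : Measurable (fun a => (p a : ℂ) • ρ a) := by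
  apply measurable_mat
  intro i j
  exact (Complex.measurable_ofReal.comp hp).mul ((measurable_entry i j).comp hρ)

lemma op_mint {α : Type*} [MeasurableSpace α] {d : ℕ} {μ : Measure α} {p : α → ℝ} {ρ : α → Mat d}
    (hpm : Measurable p) (hp0 : ∀ a, 0 ≤ p a) (hpi : Integrable p μ) (hρm : Measurable ρ)
    (hρ : ∀ a, IsState (ρ a)) :
    MInt (fun a => (p a : ℂ) • ρ a) μ ∧ (mint μ (fun a => (p a : ℂ) • ρ a)).PosSemidef ∧
    (mint μ (fun a => (p a : ℂ) • ρ a)).trace.re = ∫ a, p a ∂μ := by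
  have hps : ∀ a, ((p a : ℂ) • ρ a).PosSemidef := fun a =>
    (hρ a).1.smul (by exact_mod_cast hp0 a)
  have hM : MInt (fun a => (p a : ℂ) • ρ a) μ := by
    refine MInt.of_trace (smul_mat_meas hpm hρm) (ae_of_all _ hps) ?_
    simp only [state_smul_trace (hρ _)]
    exact hpi
  refine ⟨hM, psd_mint (ae_of_all _ hps) hM, ?_⟩
  rw [← hM.trace_re.2]
  simp only [state_smul_trace (hρ _)]

lemma pair_good {n d : ℕ} {p : En n × En n → ℝ} {ρ : En n × En n → Mat d}
    (hpm : Measurable p) (hp0 : ∀ a, 0 ≤ p a) (hpi : Integrable p) (hρm : Measurable ρ)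
    (hρ : ∀ a, IsState (ρ a))
    (hX2 : Integrable fun z : En n × En n => ‖z.1‖ ^ 2 * p z)
    (hY2 : Integrable fun z : En n × En n => ‖z.2‖ ^ 2 * p z)
    (hfin : EntFinite p ρ) : Good (fun a => (p a : ℂ) • ρ a) := by
  have hps : ∀ a, ((p a : ℂ) • ρ a).PosSemidef := fun a =>
    (hρ a).1.smul (by exact_mod_cast hp0 a)
  refine ⟨smul_mat_meas hpm hρm, hps, (op_mint hpm hp0 hpi hρm hρ).1, ?_, ?_⟩
  · simp only [state_smul_trace (hρ _)]
    refine (hX2.add hY2).mono' (hpm.mul (measurable_norm.pow_const 2)).aestronglyMeasurable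
      (ae_of_all _ fun z => ?_)
    have h0 := hp0 z
    rw [Real.norm_of_nonneg (by positivity)]
    simp only [Pi.add_apply]
    have : ‖z‖ ^ 2 ≤ ‖z.1‖ ^ 2 + ‖z.2‖ ^ 2 := by
      rcases max_choice ‖z.1‖ ‖z.2‖ with h | h
      · rw [Prod.norm_def, h]; nlinarith [sq_nonneg ‖z.2‖]
      · rw [Prod.norm_def, h]; nlinarith [sq_nonneg ‖z.1‖]
    nlinarith
  · refine ent_of_entFinite (ae_of_all _ hps) (ae_of_all _ fun a => (state_smul_trace (hρ a) _).symm)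
      (ae_of_all _ fun a ha => ?_) hfin
    have : (p a : ℂ) ≠ 0 := by exact_mod_cast ha
    rw [smul_smul, inv_mul_cancel₀ this, one_smul]

lemma marg_rep {n d : ℕ} {p : En n × En n → ℝ} {ρ : En n × En n → Mat d}
    (hpm : Measurable p) (hp0 : ∀ a, 0 ≤ p a) (hpi : Integrable p) (h1 : ∫ a, p a = 1)
    (hρm : Measurable ρ) (hρ : ∀ a, IsState (ρ a))
    (h2 : Integrable fun z : En n × En n => ‖z.1‖ ^ 2 * p z)
    (hfin : EntFinite (margFst p) (margFstState p ρ)) :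
    OpRep (margFst p) (margFstState p ρ) (fun x => (margFst p x : ℂ) • margFstState p ρ x) ∧
    ∀ᵐ x, (margFst p x : ℂ) • margFstState p ρ x
      = mint volume (fun y => (p (x, y) : ℂ) • ρ (x, y)) := by
  have hpi' : Integrable p ((volume : Measure (En n)).prod volume) := hpi
  have h2' : Integrable (fun z : En n × En n => ‖z.1‖ ^ 2 * p z)
    ((volume : Measure (En n)).prod volume) := h2
  have hsl : ∀ x, Integrable (fun y => p (x, y)) →
      MInt (fun y => (p (x, y) : ℂ) • ρ (x, y)) volume ∧
      (mint volume (fun y => (p (x, y) : ℂ) • ρ (x, y))).PosSemidef ∧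
      (mint volume (fun y => (p (x, y) : ℂ) • ρ (x, y))).trace.re = margFst p x := fun x hx =>
    op_mint (p := fun y => p (x, y)) (ρ := fun y => ρ (x, y)) (hpm.comp measurable_prodMk_left)
      (fun y => hp0 _) hx (hρm.comp measurable_prodMk_left) (fun y => hρ _)
  have hst : ∀ x, margFstState p ρ x = ((margFst p x : ℂ))⁻¹ •
      mint volume (fun y => (p (x, y) : ℂ) • ρ (x, y)) := fun x => rfl
  have hne : ∀ x, margFst p x ≠ 0 → Integrable (fun y => p (x, y)) ∧
      (margFst p x : ℂ) • margFstState p ρ x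
      = mint volume (fun y => (p (x, y) : ℂ) • ρ (x, y)) := by
    intro x hx
    constructor
    · by_contra h
      exact hx (integral_undef h)
    · have : (margFst p x : ℂ) ≠ 0 := by exact_mod_cast hx
      rw [hst, smul_smul, mul_inv_cancel₀ this, one_smul]
  have hqm : Measurable (margFst p) := by
    have := (hpm.stronglyMeasurable.integral_prod_right' (ν := (volume : Measure (En n))))
    exact this.measurable
  have hsm : Measurable (margFstState p ρ) := by
    have h := slice_meas (μ := (volume : Measure (En n))) (smul_mat_meas hpm hρm)
    have := smul_mat_meas hqm.inv h
    simp only [Pi.inv_apply, Complex.ofReal_inv] at this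
    exact this
  have hpsd : ∀ x, ((margFst p x : ℂ) • margFstState p ρ x).PosSemidef := by
    intro x
    by_cases hx : margFst p x = 0
    · rw [hx]; simpa using Matrix.PosSemidef.zero
    · rw [(hne x hx).2]; exact (hsl x (hne x hx).1).2.1
  have htr : ∀ x, margFst p x = ((margFst p x : ℂ) • margFstState p ρ x).trace.re := by
    intro x
    by_cases hx : margFst p x = 0
    · rw [hx]; simp
    · rw [(hne x hx).2]; exact (hsl x (hne x hx).1).2.2.symm
  have hs : ∀ x, margFst p x ≠ 0 → margFstState p ρ x
      = ((margFst p x : ℂ))⁻¹ • ((margFst p x : ℂ) • margFstState p ρ x) := by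
    intro x hx
    have : (margFst p x : ℂ) ≠ 0 := by exact_mod_cast hx
    rw [smul_smul, inv_mul_cancel₀ this, one_smul]
  have hqi : Integrable (margFst p) := hpi'.integral_prod_left
  refine ⟨⟨⟨smul_mat_meas hqm hsm, hpsd, ?_, ?_, ?_⟩, htr, hs, ?_⟩, ?_⟩
  · refine MInt.of_trace (smul_mat_meas hqm hsm) (ae_of_all _ hpsd) ?_
    simp only [← htr]
    exact hqi
  · simp only [← htr]
    refine h2'.integral_prod_left.congr (ae_of_all _ fun x => ?_)
    simp only
    rw [integral_const_mul, mul_comm]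
    rfl
  · exact ent_of_entFinite (ae_of_all _ hpsd) (ae_of_all _ htr) (ae_of_all _ hs) hfin
  · simp only [← htr]
    rw [← h1]
    exact (integral_prod p hpi').symm
  · filter_upwards [hpi'.prod_right_ae] with x hx
    by_cases h : margFst p x = 0
    · have h3 := hsl x hx
      rw [psd_trace_zero h3.2.1 (h3.2.2.trans h), h]; simp
    · exact (hne x h).2

section pairs
variable {n d : ℕ}

/-- The shift of a pair of variables. -/
def fab (a b : ℝ) : En n → En n × En n := fun z => (a • z, b • z)

lemma fab_meas (a b : ℝ) : Measurable (fab (n := n) a b) :=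
  (smul_meas a).prodMk (smul_meas b)

lemma fab_sq (a b : ℝ) : Integrable (fun z : En n => ‖fab a b z‖ ^ 2) (G n) := by
  refine ((smul_sq a).add (smul_sq b)).mono'
    (measurable_norm.comp (fab_meas a b) |>.pow_const 2).aestronglyMeasurable
    (ae_of_all _ fun z => ?_)
  rw [Real.norm_of_nonneg (by positivity)]
  simp only [Pi.add_apply, fab, Prod.norm_def]
  rcases max_choice ‖a • z‖ ‖b • z‖ with h | h
  · rw [h]; nlinarith [sq_nonneg ‖b • z‖]
  · rw [h]; nlinarith [sq_nonneg ‖a • z‖]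

/-- Convolution of a pair with correlated Gaussian noise. -/
def pconv (a b : ℝ) (ω : En n × En n → Mat d) : En n × En n → Mat d := nconv (G n) (fab a b) ω

lemma gconv_congr (c : ℝ) {ω ω' : En n → Mat d} (h : ω =ᵐ[volume] ω') :
    (∀ᵐ p ∂((volume : Measure (En n)).prod (G n)), ω (p.1 - c • p.2) = ω' (p.1 - c • p.2)) ∧
    gconv c ω =ᵐ[volume] gconv c ω' := by
  have h1 : ∀ᵐ p ∂((volume : Measure (En n)).prod (G n)),
      ω (p.1 - c • p.2) = ω' (p.1 - c • p.2) :=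
    (Measure.quasiMeasurePreserving_fst.comp
      (shear_mp (P := G n) (smul_meas (n := n) c)).quasiMeasurePreserving).ae h
  refine ⟨h1, ?_⟩
  filter_upwards [ae_slice h1] with w hw
  exact mint_congr hw

lemma reassoc_mp : MeasurePreserving (fun r : En n × (En n × En n) => ((r.1, r.2.2), r.2.1))
    ((volume : Measure (En n)).prod ((G n).prod volume))
    (((volume : Measure (En n)).prod volume).prod (G n)) := by
  have h1 := (MeasurePreserving.id (volume : Measure (En n))).prod
    (Measure.measurePreserving_swap (μ := G n) (ν := (volume : Measure (En n))))
  have h2 := (measurePreserving_prodAssoc (volume : Measure (En n)) (volume : Measure (En n))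
    (G n)).symm
  exact h2.comp h1

lemma pair_shift_mint (a b : ℝ) {ω : En n × En n → Mat d} (hM : MInt ω volume) :
    MInt (fun r : En n × (En n × En n) => ω ((r.1, r.2.2) - fab a b r.2.1))
    ((volume : Measure (En n)).prod ((G n).prod volume)) :=
  (MInt.comp reassoc_mp (shift_mint (V := En n × En n) (P := G n) (fab_meas a b) hM)).1

lemma pair_inner (a b : ℝ) (ω : En n × En n → Mat d) (x z : En n) :
    mint volume (fun y => ω ((x, y) - fab a b z)) = mint volume (fun y => ω (x - a • z, y)) := by
  ext i j
  simp only [mint, Matrix.of_apply, fab, Prod.mk_sub_mk]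
  exact integral_sub_right_eq_self (fun y => ω (x - a • z, y) i j) (b • z)

lemma marg_conv0 (a b : ℝ) {ω : En n × En n → Mat d} (hM : MInt ω volume) {ωX : En n → Mat d}
    (h : ∀ᵐ x, ωX x = mint volume (fun y => ω (x, y))) :
    ∀ᵐ x, mint ((G n).prod volume) (fun r : En n × En n => ω ((x, r.2) - fab a b r.1))
      = gconv a ωX x := by
  filter_upwards [(pair_shift_mint a b hM).slice, (gconv_congr a h).2] with x hx hc
  have h1 := hx.marg.2
  rw [hc, ← h1]
  simp only [pair_inner]
  rfl

lemma marg_conv (a b : ℝ) {ω : En n × En n → Mat d} (hM : MInt ω volume) {ωX : En n → Mat d}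
    (h : ∀ᵐ x, ωX x = mint volume (fun y => ω (x, y))) :
    ∀ᵐ x, mint volume (fun y => pconv a b ω (x, y)) = gconv a ωX x := by
  filter_upwards [(pair_shift_mint a b hM).slice, marg_conv0 a b hM h] with x hx hc
  rw [← hc]
  exact hx.marg'.2

lemma step1 (c a : ℝ) {ω : En n × En n → Mat d} (hm : Measurable ω) (hp : ∀ v, (ω v).PosSemidef)
    (hM : MInt ω volume) (hv : Integrable (fun v => vnEnt (ω v)))
    (hv' : Integrable (fun v => vnEnt (pconv c a ω v))) {ωS : En n → Mat d} (hS : Good ωS)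
    (h : ∀ᵐ x, ωS x = mint volume (fun y => ω (x, y))) :
    H (gconv c ωS) - H ωS ≤ H (pconv c a ω) - H ω := by
  set A : En n × (En n × En n) → Mat d := fun r => ω ((r.1, r.2.2) - fab c a r.2.1) with hA
  have hAm : Measurable A :=
    (shift_meas (V := En n × En n) (fab_meas c a) hm).comp reassoc_mp.measurable
  have sv := shift_int (V := En n × En n) (P := G n) (fab_meas c a) hv
  have sA := reassoc_mp.integral_eq sv.1
  have e0 := marg_conv0 c a hM h
  have e1 : ∀ᵐ q ∂((volume : Measure (En n)).prod (G n)),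
      mint volume (fun y => A (q.1, (q.2, y))) = ωS (q.1 - c • q.2) := by
    filter_upwards [(gconv_congr c h).1] with q hq
    rw [hq, hA]
    exact pair_inner c a ω q.1 q.2
  have s1 := shift_int (V := En n) (P := G n) (smul_meas c) hS.ent
  have e1' : (fun q : En n × En n => vnEnt (mint volume (fun y => A (q.1, (q.2, y)))))
      =ᵐ[(volume : Measure (En n)).prod (G n)] fun q => vnEnt (ωS (q.1 - c • q.2)) := by
    filter_upwards [e1] with q hq
    rw [hq]
  have e0' : (fun x => vnEnt (mint ((G n).prod volume) (fun r => A (x, r))))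
      =ᵐ[(volume : Measure (En n))] fun x => vnEnt (gconv c ωS x) := by
    filter_upwards [e0] with q hq
    rw [← hq]
  have key := ssa_cond (κ := (volume : Measure (En n))) (ν := G n) (μ := (volume : Measure (En n)))
    (A := A) hAm (ae_of_all _ fun r => hp _) (pair_shift_mint c a hM) sA.1
    (s1.1.congr e1'.symm) hv' ((gconv_ent c hS).1.congr e0'.symm)
  rw [integral_congr_ae e1', integral_congr_ae e0', s1.2] at key
  have e3 : ∫ p, vnEnt (A p) ∂((volume : Measure (En n)).prod ((G n).prod volume)) = H ω :=
    sA.2.trans sv.2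
  rw [e3] at key
  exact key

lemma T_mp : MeasurePreserving (fun r : En n × En n => (r.2, r.1 - r.2))
    (volume : Measure (En n × En n)) volume := by
  have h := (measurePreserving_prod_sub (volume : Measure (En n)) (volume : Measure (En n))).comp
    (Measure.measurePreserving_swap (μ := (volume : Measure (En n))) (ν := (volume : Measure (En n))))
  exact h

lemma pconv_T (a b : ℝ) (ω : En n × En n → Mat d) (r : En n × En n) :
    pconv (a + b) a (fun r => ω (r.2, r.1 - r.2)) r = pconv a b ω (r.2, r.1 - r.2) := by
  simp only [pconv, nconv, fab]
  congr 1
  funext z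
  congr 1
  simp only [Prod.fst_sub, Prod.snd_sub, Prod.mk_sub_mk, add_smul]
  congr 1
  abel

lemma step1' (a b : ℝ) {ω : En n × En n → Mat d} (hω : Good ω) {ωS : En n → Mat d}
    (hS : Good ωS) (h : ∀ᵐ s, ωS s = mint volume (fun x => ω (x, s - x))) :
    H (gconv (a + b) ωS) - H ωS ≤ H (pconv a b ω) - H ω := by
  have he := (nconv_ent (P := G n) (hexpP n) (fab_meas a b) (fab_sq a b) hω).1
  have h1 := T_mp.integral_eq he
  have h2 := T_mp.integral_eq hω.ent
  have key := step1 (a + b) a (ω := fun r => ω (r.2, r.1 - r.2))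
    (hω.meas.comp T_mp.measurable) (fun v => hω.psd _) (MInt.comp T_mp hω.mi).1 h2.1
    (by simp only [pconv_T]; exact h1.1) hS h
  have e1 : H (pconv (a + b) a (fun r => ω (r.2, r.1 - r.2))) = H (pconv a b ω) := by
    simp only [H, pconv_T]; exact h1.2
  have e2 : H (fun r : En n × En n => ω (r.2, r.1 - r.2)) = H ω := h2.2
  rw [e1, e2] at key
  exact key

end pairs

section step2
variable {n d : ℕ}

lemma gdf_meas : Measurable (fun z : En n × En n => ENNReal.ofReal (gaussDensity n z.1)) :=
  (gd_meas n).ennreal_ofReal.comp measurable_fst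

lemma Gprod_integrable {E : Type*} [NormedAddCommGroup E] [NormedSpace ℝ E]
    {f : En n × En n → E} :
    Integrable f ((G n).prod volume) ↔
      Integrable (fun z => gaussDensity n z.1 • f z) ((volume : Measure (En n)).prod volume) := by
  rw [G, prod_withDensity_left (gd_meas n).ennreal_ofReal,
    integrable_withDensity_iff_integrable_smul' gdf_meas
    (ae_of_all _ fun _ => ENNReal.ofReal_lt_top)]
  simp only [ENNReal.toReal_ofReal (gd_pos n _).le]

lemma Gprod_integral {E : Type*} [NormedAddCommGroup E] [NormedSpace ℝ E]
    {f : En n × En n → E} :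
    ∫ z, f z ∂((G n).prod volume) =
      ∫ z, gaussDensity n z.1 • f z ∂((volume : Measure (En n)).prod volume) := by
  rw [G, prod_withDensity_left (gd_meas n).ennreal_ofReal,
    integral_withDensity_eq_integral_toReal_smul gdf_meas
    (ae_of_all _ fun _ => ENNReal.ofReal_lt_top)]
  simp only [ENNReal.toReal_ofReal (gd_pos n _).le]

lemma Gprod_ae {P : En n × En n → Prop} (h : ∀ᵐ z, P z) :
    ∀ᵐ z ∂((G n).prod (volume : Measure (En n))), P z := by
  rw [G, prod_withDensity_left (gd_meas n).ennreal_ofReal]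
  exact (withDensity_absolutelyContinuous _ _).ae_le h

lemma G_ae {P : En n → Prop} (h : ∀ᵐ z, P z) : ∀ᵐ z ∂(G n), P z := by
  rw [G]
  exact (withDensity_absolutelyContinuous _ _).ae_le h

lemma g_vnEnt {A : Mat d} (hA : A.PosSemidef) (x : En n) :
    gaussDensity n x • vnEnt (((gaussDensity n x)⁻¹ : ℝ) • A) =
      vnEnt A + Real.log (gaussDensity n x) * A.trace.re := by
  have h0 := gd_pos n x
  have : ((gaussDensity n x)⁻¹ : ℝ) • A = (((gaussDensity n x)⁻¹ : ℝ) : ℂ) • A := by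
    ext i j; simp
  rw [this, vnEnt_smul hA.1, Real.log_inv, smul_eq_mul]
  field_simp
  ring

lemma step2 {ω : En n × En n → Mat d} (hm : Measurable ω) (hp : ∀ᵐ v, (ω v).PosSemidef)
    (hM : MInt ω volume) (hv : Integrable (fun v => vnEnt (ω v)))
    (hL : Integrable (fun v => Real.log (gaussDensity n v.1) * (ω v).trace.re))
    (hv1 : Integrable (fun x => vnEnt (mint volume (fun y => ω (x, y)))))
    (hv2 : Integrable (fun y => vnEnt (mint volume (fun x => ω (x, y))))) :
    H ω ≤ (∫ x, vnEnt (mint volume (fun y => ω (x, y))))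
      + (∫ y, vnEnt (mint volume (fun x => ω (x, y)))) - vnEnt (mint volume ω) := by
  rw [Measure.volume_eq_prod] at hp hM hv hL
  set A : En n × En n → Mat d := fun v => ((gaussDensity n v.1)⁻¹ : ℝ) • ω v with hA
  have hg0 := gd_pos n
  have hAm : Measurable A := by
    apply measurable_mat
    intro i j
    exact Measurable.smul (f := fun v : En n × En n => ((gaussDensity n v.1)⁻¹ : ℝ))
      ((gd_meas n).comp measurable_fst).inv ((measurable_entry i j).comp hm)
  have hAp : ∀ᵐ v ∂((G n).prod (volume : Measure (En n))), (A v).PosSemidef := by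
    filter_upwards [Gprod_ae hp] with v h
    exact h.smul (inv_nonneg.2 (hg0 v.1).le)
  have gA : ∀ v i j, gaussDensity n v.1 • A v i j = ω v i j := by
    intro v i j
    simp only [hA, Matrix.smul_apply]
    rw [smul_smul, mul_inv_cancel₀ (hg0 _).ne', one_smul]
  have hAM : MInt A ((G n).prod (volume : Measure (En n))) := by
    intro i j
    rw [Gprod_integrable]
    simp only [gA]
    exact hM i j
  have eT : mint ((G n).prod (volume : Measure (En n))) A = mint volume ω := by
    ext i j
    simp only [mint, Matrix.of_apply]
    rw [Gprod_integral]
    simp only [gA]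
    rfl
  have ev : (fun v => gaussDensity n v.1 • vnEnt (A v)) =ᵐ[(volume : Measure (En n)).prod volume]
      fun v => vnEnt (ω v) + Real.log (gaussDensity n v.1) * (ω v).trace.re := by
    filter_upwards [hp] with v h
    exact g_vnEnt h v.1
  have m2 : ∀ y, mint (G n) (fun x => A (x, y)) = mint volume (fun x => ω (x, y)) := by
    intro y
    ext i j
    simp only [mint, Matrix.of_apply]
    rw [G_integral]
    congr 1; funext x
    exact gA (x, y) i j
  have m1 : ∀ x, mint volume (fun y => A (x, y))
      = ((gaussDensity n x)⁻¹ : ℝ) • mint volume (fun y => ω (x, y)) := by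
    intro x
    ext i j
    simp only [mint, Matrix.of_apply, hA, Matrix.smul_apply]
    exact integral_smul _ _
  have hL1 : (fun x => ∫ y, Real.log (gaussDensity n x) * (ω (x, y)).trace.re)
      =ᵐ[(volume : Measure (En n))] fun x => Real.log (gaussDensity n x) *
        (mint volume (fun y => ω (x, y))).trace.re := by
    filter_upwards [hM.slice] with x hx
    rw [integral_const_mul, hx.trace_re.2]
  have hL2 : Integrable (fun x => Real.log (gaussDensity n x) *
        (mint volume (fun y => ω (x, y))).trace.re) := hL.integral_prod_left.congr hL1
  have ev1 : (fun x => gaussDensity n x • vnEnt (mint volume (fun y => A (x, y))))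
      =ᵐ[(volume : Measure (En n))] fun x => vnEnt (mint volume (fun y => ω (x, y))) +
        Real.log (gaussDensity n x) * (mint volume (fun y => ω (x, y))).trace.re := by
    filter_upwards [psd_marg hp hM] with x h
    rw [m1]
    exact g_vnEnt h x
  have key := ssa (ν := G n) (μ := (volume : Measure (En n))) hAm hAp hAM
    (Gprod_integrable.2 ((hv.add hL).congr ev.symm))
    (G_integrable.2 ((hv1.add hL2).congr ev1.symm))
    (by simp only [m2]; exact hv2)
  simp only [m2] at key
  rw [eT, G_integral, Gprod_integral, integral_congr_ae ev, integral_congr_ae ev1,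
    integral_add hv hL, integral_add hv1 hL2, ← integral_congr_ae hL1, integral_prod _ hL] at key
  have : H ω = ∫ v, vnEnt (ω v) ∂((volume : Measure (En n)).prod volume) := rfl
  rw [this]
  linarith

lemma log_gd (x : En n) : Real.log (gaussDensity n x)
    = Real.log ((2 * π) ^ (-(n : ℝ) / 2)) - ‖x‖ ^ 2 / 2 := by
  rw [gaussDensity, Real.log_mul (by positivity) (by positivity), Real.log_exp]; ring

/-- The key inequality for the entropy increments. -/
lemma stam_step (a b : ℝ) {ω : En n × En n → Mat d} (hω : Good ω) {ωX ωY ωS : En n → Mat d}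
    (hX : Good ωX) (hY : Good ωY) (hS : Good ωS)
    (eX : ∀ᵐ x, ωX x = mint volume (fun y => ω (x, y)))
    (eY : ∀ᵐ y, ωY y = mint volume (fun x => ω (x, y)))
    (eS : ∀ᵐ s, ωS s = mint volume (fun x => ω (x, s - x)))
    (hind : H ω = H ωX + H ωY - vnEnt (mint volume ω)) :
    H (gconv (a + b) ωS) - H ωS ≤ (H (gconv a ωX) - H ωX) + (H (gconv b ωY) - H ωY) := by
  have h1 := step1' a b hω hS eS
  have hmp := shift_mint (V := En n × En n) (P := G n) (fab_meas a b) hω.mi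
  have hpp : ∀ᵐ v, (pconv a b ω v).PosSemidef :=
    psd_marg (A := fun p : (En n × En n) × En n => ω (p.1 - fab a b p.2))
      (ae_of_all _ fun p => hω.psd _) hmp
  have hmm : Measurable (pconv a b ω) :=
    slice_meas (A := fun p : (En n × En n) × En n => ω (p.1 - fab a b p.2))
      (shift_meas (fab_meas a b) hω.meas)
  have hMM : MInt (pconv a b ω) volume := hmp.marg.1
  have hT : mint volume (pconv a b ω) = mint volume ω := by
    have e1 : mint volume (pconv a b ω) = _ := hmp.marg.2
    rw [e1]
    ext i j
    simp only [mint, Matrix.of_apply]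
    exact (shift_int (V := En n × En n) (P := G n) (fab_meas a b) (hω.mi i j)).2
  have he := (nconv_ent (P := G n) (hexpP n) (fab_meas a b) (fab_sq a b) hω).1
  have hsq := nconv_sq (P := G n) (fab_meas a b) (fab_sq a b) hω
  have hL : Integrable (fun v => Real.log (gaussDensity n v.1) * (pconv a b ω v).trace.re) := by
    have j1 := hMM.trace_re.1
    have j2 : Integrable (fun v => ‖v.1‖ ^ 2 * (pconv a b ω v).trace.re) := by
      refine Integrable.mono' hsq ((measurable_fst.norm.pow_const 2).mul
        (meas_tr.comp hmm)).aestronglyMeasurable ?_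
      filter_upwards [hpp] with v hv
      have h0 := psd_trace_nonneg hv
      rw [Real.norm_of_nonneg (by positivity), mul_comm]
      have : ‖v.1‖ ^ 2 ≤ ‖v‖ ^ 2 := pow_le_pow_left₀ (norm_nonneg _) (norm_fst_le v) 2
      exact mul_le_mul_of_nonneg_left this h0
    refine ((j1.const_mul (Real.log ((2 * π) ^ (-(n : ℝ) / 2)))).sub (j2.div_const 2)).congr
      (ae_of_all _ fun v => ?_)
    simp only [Pi.sub_apply, log_gd]
    ring
  have cX := marg_conv a b hω.mi eX
  have cY : ∀ᵐ y, mint volume (fun x => pconv a b ω (x, y)) = gconv b ωY y :=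
    marg_conv b a (ω := fun p : En n × En n => ω (p.2, p.1))
      (MInt.swap (ν := (volume : Measure (En n))) (μ := (volume : Measure (En n))) hω.mi) eY
  have cX' : (fun x => vnEnt (mint volume (fun y => pconv a b ω (x, y))))
      =ᵐ[volume] fun x => vnEnt (gconv a ωX x) := by
    filter_upwards [cX] with x h; rw [h]
  have cY' : (fun y => vnEnt (mint volume (fun x => pconv a b ω (x, y))))
      =ᵐ[volume] fun y => vnEnt (gconv b ωY y) := by
    filter_upwards [cY] with x h; rw [h]
  have h2 := step2 hmm hpp hMM he hL ((gconv_ent a hX).1.congr cX'.symm)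
    ((gconv_ent b hY).1.congr cY'.symm)
  rw [integral_congr_ae cX', integral_congr_ae cY', hT] at h2
  have h3 : H (pconv a b ω) ≤ H (gconv a ωX) + H (gconv b ωY) - vnEnt (mint volume ω) := h2
  linarith

end step2

lemma fisherSlope_eq {n d : ℕ} {q : En n → ℝ} {σ ω : En n → Mat d} (h : OpRep q σ ω) (t : ℝ) :
    fisherSlope q σ t = (H (gconv (Real.sqrt t) ω) - H ω) / t := by
  rw [fisherSlope, noisyMI_eq h]

lemma final_ineq {JS JX JY : ℝ} (hS : 0 < JS) (hX : 0 < JX) (hY : 0 < JY)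
    (h : JS ≤ JX * JY / (JX + JY)) : 1 / JS ≥ 1 / JX + 1 / JY := by
  have h1 : 1 / JX + 1 / JY = 1 / (JX * JY / (JX + JY)) := by
    field_simp
    ring
  rw [h1]
  exact one_div_le_one_div_of_le hS h

lemma stam_limit {n d : ℕ} {ωX ωY ωS : En n → Mat d} {JX JY : ℝ}
    (key : ∀ a b : ℝ, H (gconv (a + b) ωS) - H ωS ≤
      (H (gconv a ωX) - H ωX) + (H (gconv b ωY) - H ωY))
    (hX0 : 0 < JX) (hY0 : 0 < JY)
    (hJX : Tendsto (fun t => (H (gconv (Real.sqrt t) ωX) - H ωX) / t) (𝓝[>] 0) (𝓝 JX))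
    (hJY : Tendsto (fun t => (H (gconv (Real.sqrt t) ωY) - H ωY) / t) (𝓝[>] 0) (𝓝 JY))
    (gX : Good ωX) (gS : Good ωS) (oS : ∫ x, (ωS x).trace.re = 1) :
    ∃ JS : ℝ, Tendsto (fun t => (H (gconv (Real.sqrt t) ωS) - H ωS) / t) (𝓝[>] 0) (𝓝 JS) ∧
      1 / JS ≥ 1 / JX + 1 / JY := by
  rcases Nat.eq_zero_or_pos n with rfl | hn
  · exfalso
    have h0 : ∀ c, gconv c ωX = ωX := by
      intro c
      funext x
      ext i j
      simp only [gconv, nconv, mint, Matrix.of_apply]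
      have : ∀ z : En 0, x - c • z = x := fun z => Subsingleton.elim _ _
      simp [this]
    simp only [h0, sub_self, zero_div] at hJX
    exact hX0.ne (tendsto_nhds_unique tendsto_const_nhds hJX)
  set φ : ℝ → ℝ := fun t => H (gconv (Real.sqrt t) ωS) - H ωS with hφ
  set l := JY / (JX + JY) with hl
  have hl0 : 0 < l := by positivity
  have hl1 : 1 - l = JX / (JX + JY) := by rw [hl]; field_simp; ring
  have hm0 : 0 < 1 - l := by rw [hl1]; positivity
  have sc : ∀ m : ℝ, 0 < m → Tendsto (fun t : ℝ => m ^ 2 * t) (𝓝[>] 0) (𝓝[>] 0) := by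
    intro m hm
    refine tendsto_nhdsWithin_iff.2 ⟨?_, ?_⟩
    · have : Tendsto (fun t : ℝ => m ^ 2 * t) (𝓝 0) (𝓝 (m ^ 2 * 0)) :=
        Continuous.tendsto (by fun_prop) 0
      rw [mul_zero] at this
      exact this.mono_left nhdsWithin_le_nhds
    · filter_upwards [self_mem_nhdsWithin] with t ht
      have : 0 < t := ht
      exact (by positivity : 0 < m ^ 2 * t)
  have lim : Tendsto (fun t => l ^ 2 * ((H (gconv (Real.sqrt (l ^ 2 * t)) ωX) - H ωX) / (l ^ 2 * t))
      + (1 - l) ^ 2 * ((H (gconv (Real.sqrt ((1 - l) ^ 2 * t)) ωY) - H ωY) / ((1 - l) ^ 2 * t)))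
      (𝓝[>] 0) (𝓝 (l ^ 2 * JX + (1 - l) ^ 2 * JY)) :=
    ((hJX.comp (sc l hl0)).const_mul _).add ((hJY.comp (sc (1 - l) hm0)).const_mul _)
  have eJ : l ^ 2 * JX + (1 - l) ^ 2 * JY = JX * JY / (JX + JY) := by
    rw [hl1, hl]; field_simp; ring
  rw [eJ] at lim
  set K := JX * JY / (JX + JY) with hK
  have bd : ∀ t : ℝ, 0 < t → φ t / t ≤
      l ^ 2 * ((H (gconv (Real.sqrt (l ^ 2 * t)) ωX) - H ωX) / (l ^ 2 * t))
      + (1 - l) ^ 2 * ((H (gconv (Real.sqrt ((1 - l) ^ 2 * t)) ωY) - H ωY) / ((1 - l) ^ 2 * t)) := by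
    intro t ht
    have h := key (l * Real.sqrt t) ((1 - l) * Real.sqrt t)
    have e : l * Real.sqrt t + (1 - l) * Real.sqrt t = Real.sqrt t := by ring
    rw [e] at h
    rw [Real.sqrt_mul (sq_nonneg _), Real.sqrt_mul (sq_nonneg _), Real.sqrt_sq hl0.le,
      Real.sqrt_sq hm0.le]
    have e2 : ∀ u m : ℝ, 0 < m → m ^ 2 * (u / (m ^ 2 * t)) = u / t := by
      intro u m hm
      field_simp
    rw [e2 _ _ hl0, e2 _ _ hm0, ← add_div]
    exact div_le_div_of_nonneg_right h ht.le
  have hev : ∀ᶠ t in 𝓝[>] (0 : ℝ), φ t / t ≤ K + 1 := by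
    filter_upwards [lim.eventually (gt_mem_nhds (lt_add_one K)), self_mem_nhdsWithin] with t h1 h2
    exact (bd t h2).trans h1.le
  obtain ⟨ε, hε, hεs⟩ := (mem_nhdsGT_iff_exists_Ioo_subset).1 hev
  have hsub : ∀ s t : ℝ, 0 < s → 0 < t → φ (s + t) ≤ φ s + φ t := by
    intro s t hs ht
    have := gconv_subadd (a := Real.sqrt s) (b := Real.sqrt t) (c := Real.sqrt (s + t)) (by
      rw [Real.sq_sqrt hs.le, Real.sq_sqrt ht.le, Real.sq_sqrt (by positivity)]) gS
    simp only [hφ]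
    linarith
  have hnn : ∀ t : ℝ, 0 < t → 0 ≤ φ t := by
    intro t _
    have := (gconv_ent (Real.sqrt t) gS).2
    simp only [hφ]; linarith
  obtain ⟨L, hL, hLs⟩ := fekete hnn hsub (ε := ε / 2) (C := K + 1) (half_pos hε) (by
    intro t ht hte
    have : φ t / t ≤ K + 1 := hεs ⟨ht, by have : (0:ℝ) < ε := hε; linarith⟩
    rwa [div_le_iff₀ ht] at this)
  refine ⟨L, hL, final_ineq ?_ hX0 hY0 ?_⟩
  · obtain ⟨c, hc, hlt⟩ := exists_gconv_lt hn gS oS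
    have h2 := hLs (c ^ 2) (by positivity)
    have : 0 < φ (c ^ 2) := by
      simp only [hφ, Real.sqrt_sq hc.le]; linarith
    exact lt_of_lt_of_le (by positivity) h2
  · refine le_of_tendsto_of_tendsto hL lim ?_
    filter_upwards [self_mem_nhdsWithin] with t ht
    exact bd t ht

/-- The Stam inequality with quantum conditioning: for `X`, `Y` conditionally independent
given the quantum system `M`, with finite strictly positive conditional Fisher informations
`J(X|M)` and `J(Y|M)`, one has `1/J(X+Y|M) ≥ 1/J(X|M) + 1/J(Y|M)` (in particular
`J(X+Y|M)` is finite). -/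
theorem stam_inequality_quantum_conditioning {n d : ℕ}
    (p : En n × En n → ℝ) (ρ : En n × En n → Matrix (Fin d) (Fin d) ℂ)
    (hcq : IsCQState p ρ)
    (hX2 : Integrable fun z : En n × En n => ‖z.1‖ ^ 2 * p z)
    (hY2 : Integrable fun z : En n × En n => ‖z.2‖ ^ 2 * p z)
    (hXYfin : EntFinite p ρ)
    (hXfin : EntFinite (margFst p) (margFstState p ρ))
    (hYfin : EntFinite (margSnd p) (margSndState p ρ))
    (hSfin : EntFinite (sumDensity p) (sumState p ρ))
    (hindep : condMI p ρ = 0)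
    -- `J(X|M)` and `J(Y|M)` are finite and strictly positive:
    (JX JY : ℝ) (hJXpos : 0 < JX) (hJYpos : 0 < JY)
    (hJX : Tendsto (fisherSlope (margFst p) (margFstState p ρ)) (𝓝[>] 0) (𝓝 JX))
    (hJY : Tendsto (fisherSlope (margSnd p) (margSndState p ρ)) (𝓝[>] 0) (𝓝 JY)) :
    ∃ JS : ℝ, Tendsto (fisherSlope (sumDensity p) (sumState p ρ)) (𝓝[>] 0) (𝓝 JS) ∧
      1 / JS ≥ 1 / JX + 1 / JY := by
  obtain ⟨hpm, hp0, h1, hρc, hρ⟩ := hcq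
  have hρm : Measurable (fun z => (ρ z : Mat d)) := hρc.measurable
  have hpi : Integrable p := by
    by_contra h
    rw [integral_undef h] at h1
    exact zero_ne_one h1
  have hω := pair_good hpm hp0 hpi hρm hρ hX2 hY2 hXYfin
  set ω : En n × En n → Mat d := fun a => (p a : ℂ) • ρ a with hωdef
  -- the marginal of `X`
  obtain ⟨rX, eX⟩ := marg_rep hpm hp0 hpi h1 hρm hρ hX2 hXfin
  -- the marginal of `Y`
  have hsw : MeasurePreserving (fun z : En n × En n => (z.2, z.1))
      (volume : Measure (En n × En n)) volume :=
    Measure.measurePreserving_swap (μ := (volume : Measure (En n))) (ν := (volume : Measure (En n)))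
  obtain ⟨rY, eY⟩ := marg_rep (p := fun z => p (z.2, z.1)) (ρ := fun z => ρ (z.2, z.1))
    (hpm.comp hsw.measurable) (fun z => hp0 _) (hsw.integral_eq hpi).1
    ((hsw.integral_eq hpi).2.trans h1) (hρm.comp hsw.measurable) (fun z => hρ _)
    (hsw.integral_eq hY2).1 hYfin
  -- the sum
  have hS2 : Integrable (fun z : En n × En n => ‖z.1 + z.2‖ ^ 2 * p z) := by
    refine ((hX2.const_mul 2).add (hY2.const_mul 2)).mono'
      (((measurable_fst.add measurable_snd).norm.pow_const 2).mul hpm).aestronglyMeasurable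
      (ae_of_all _ fun z => ?_)
    have h0 := hp0 z
    rw [Real.norm_of_nonneg (by positivity)]
    simp only [Pi.add_apply]
    have := norm_add_le z.1 z.2
    have h3 : ‖z.1 + z.2‖ ^ 2 ≤ 2 * ‖z.1‖ ^ 2 + 2 * ‖z.2‖ ^ 2 := by
      nlinarith [norm_nonneg (z.1 + z.2), sq_nonneg (‖z.1‖ - ‖z.2‖)]
    nlinarith
  have hS2' := (T_mp.integral_eq hS2).1
  simp only [add_sub_cancel] at hS2'
  obtain ⟨rS, eS⟩ := marg_rep (p := fun z => p (z.2, z.1 - z.2))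
    (ρ := fun z => ρ (z.2, z.1 - z.2))
    (hpm.comp T_mp.measurable) (fun z => hp0 _) (T_mp.integral_eq hpi).1
    ((T_mp.integral_eq hpi).2.trans h1) (hρm.comp T_mp.measurable) (fun z => hρ _)
    hS2' hSfin
  set ωX : En n → Mat d := fun x => (margFst p x : ℂ) • margFstState p ρ x with hωX
  set ωY : En n → Mat d := fun x => (margFst (fun z : En n × En n => p (z.2, z.1)) x : ℂ) •
    margFstState (fun z : En n × En n => p (z.2, z.1)) (fun z => ρ (z.2, z.1)) x with hωY
  set ωS : En n → Mat d := fun x => (margFst (fun z : En n × En n => p (z.2, z.1 - z.2)) x : ℂ) •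
    margFstState (fun z : En n × En n => p (z.2, z.1 - z.2)) (fun z => ρ (z.2, z.1 - z.2)) x
    with hωS
  have rY' : OpRep (margSnd p) (margSndState p ρ) ωY := rY
  have rS' : OpRep (sumDensity p) (sumState p ρ) ωS := rS
  -- conditional independence
  have mX : mint volume ωX = mint volume ω := by
    rw [mint_congr eX]
    exact (MInt.marg (ν := (volume : Measure (En n))) (μ := (volume : Measure (En n))) hω.mi).2
  have mY : mint volume ωY = mint volume ω := by
    rw [mint_congr eY]
    exact (MInt.marg' (ν := (volume : Measure (En n))) (μ := (volume : Measure (En n))) hω.mi).2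
  have cX : condEnt (margFst p) (margFstState p ρ) = H ωX - vnEnt (mint volume ωX) :=
    condEnt_eq' (ae_of_all _ rX.good.psd) (ae_of_all _ rX.tr) (ae_of_all _ rX.st)
      rX.good.mi rX.good.ent
  have cY : condEnt (margSnd p) (margSndState p ρ) = H ωY - vnEnt (mint volume ωY) :=
    condEnt_eq' (ae_of_all _ rY'.good.psd) (ae_of_all _ rY'.tr) (ae_of_all _ rY'.st)
      rY'.good.mi rY'.good.ent
  have cXY : condEnt p ρ = H ω - vnEnt (mint volume ω) := by
    refine condEnt_eq' (ae_of_all _ hω.psd) (ae_of_all _ fun a => (state_smul_trace (hρ a) _).symm)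
      (ae_of_all _ fun a ha => ?_) hω.mi hω.ent
    have : (p a : ℂ) ≠ 0 := by exact_mod_cast ha
    simp only [hωdef]
    rw [smul_smul, inv_mul_cancel₀ this, one_smul]
  have hind : H ω = H ωX + H ωY - vnEnt (mint volume ω) := by
    rw [condMI, cX, cY, cXY, mX, mY] at hindep
    linarith
  have key := fun a b : ℝ => stam_step a b hω rX.good rY'.good rS'.good eX eY eS hind
  have fX : fisherSlope (margFst p) (margFstState p ρ)
      = fun t => (H (gconv (Real.sqrt t) ωX) - H ωX) / t := funext (fisherSlope_eq rX)
  have fY : fisherSlope (margSnd p) (margSndState p ρ)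
      = fun t => (H (gconv (Real.sqrt t) ωY) - H ωY) / t := funext (fisherSlope_eq rY')
  have fS : fisherSlope (sumDensity p) (sumState p ρ)
      = fun t => (H (gconv (Real.sqrt t) ωS) - H ωS) / t := funext (fisherSlope_eq rS')
  rw [fX] at hJX
  rw [fY] at hJY
  rw [fS]
  have gX := rX.good
  have gS := rS'.good
  have oS := rS'.one
  clear_value ωX ωY ωS ω
  exact stam_limit key hJXpos hJYpos hJX hJY gX gS oS

end
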